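/- Let (Γ_i)_{i∈I} and (Λ_j)_{j∈J} be families of infinite countable measurably freely indecomposable groups, I = {1,…,n}, J = {1,…,m}, n, m ∈ ℕ* ∪ {∞}, and let Γ₀ and Λ₀ be countable groups each measure equivalent to some free group. If the group free products (*_{i∈I} Γ_i) * Γ₀ and (*_{j∈J} Λ_j) * Λ₀ are measure equivalent, then there exist maps θ : I → J and θ' : J → I such that Γ_i is measure equivalent to Λ_{θ(i)} for every i ∈ I and Λ_j is measure equivalent to Γ_{θ'(j)} for every j ∈ J. In particular the same conclusion holds when Γ₀ = Λ₀ = {1}, i.e. when *_{i∈I} Γ_i and *_{j∈J} Λ_j are measure equivalent. -/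

import Mathlib

open MeasureTheory

/-- A countable Borel equivalence relation on `X`, defined on a Borel domain `dom`:
it is Borel as a subset of `X × X`, is an equivalence relation on `dom`, and has
countable classes. -/
structure CBER (X : Type) [MeasurableSpace X] where
  dom : Set X
  dom_meas : MeasurableSet dom
  rel : X → X → Prop
  rel_meas : MeasurableSet {p : X × X | rel p.1 p.2}
  rel_dom : ∀ {x y : X}, rel x y → x ∈ dom ∧ y ∈ dom
  refl : ∀ x ∈ dom, rel x x
  symm : ∀ {x y : X}, rel x y → rel y x
  trans : ∀ {x y z : X}, rel x y → rel y z → rel x z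
  countable_classes : ∀ x : X, {y | rel x y}.Countable

/-- The class of `x`. -/
def CBER.cls {X : Type} [MeasurableSpace X] (R : CBER X) (x : X) : Set X := {y | R.rel x y}

/-- The `R`-saturation of a set `A`: the union of the `R`-classes meeting `A`. -/
def CBER.sat {X : Type} [MeasurableSpace X] (R : CBER X) (A : Set X) : Set X :=
  {y | ∃ x ∈ A, R.rel x y}

/-- A complete section: a Borel subset of the domain meeting every class. -/
def CBER.IsCompleteSection {X : Type} [MeasurableSpace X] (R : CBER X) (A : Set X) : Prop :=
  MeasurableSet A ∧ A ⊆ R.dom ∧ ∀ x ∈ R.dom, ∃ y ∈ A, R.rel x y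

/-- A smooth CBER: one admitting a Borel fundamental domain (a Borel set meeting
every class exactly once). -/
def CBER.Smooth {X : Type} [MeasurableSpace X] (R : CBER X) : Prop :=
  ∃ D : Set X, MeasurableSet D ∧ D ⊆ R.dom ∧ ∀ x ∈ R.dom, ∃! y, y ∈ D ∧ R.rel x y

/-- Smoothness of the restriction `R|A`. -/
def CBER.SmoothOn {X : Type} [MeasurableSpace X] (R : CBER X) (A : Set X) : Prop :=
  ∃ D : Set X, MeasurableSet D ∧ D ⊆ A ∧ ∀ x ∈ R.dom ∩ A, ∃! y, y ∈ D ∧ R.rel x y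

/-- All classes are finite. -/
def CBER.FiniteClasses {X : Type} [MeasurableSpace X] (R : CBER X) : Prop :=
  ∀ x ∈ R.dom, (R.cls x).Finite

/-- Aperiodic: all classes are infinite (on the domain). -/
def CBER.Aperiodic {X : Type} [MeasurableSpace X] (R : CBER X) : Prop :=
  ∀ x ∈ R.dom, (R.cls x).Infinite

/-- Trivial: all classes are singletons. -/
def CBER.TrivialClasses {X : Type} [MeasurableSpace X] (R : CBER X) : Prop :=
  ∀ x y, R.rel x y → x = y

/-- The restriction `R|U` of `R` to a Borel set `U`. -/
def CBER.restrict {X : Type} [MeasurableSpace X] (R : CBER X) (U : Set X)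
    (hU : MeasurableSet U) : CBER X where
  dom := R.dom ∩ U
  dom_meas := R.dom_meas.inter hU
  rel x y := R.rel x y ∧ x ∈ U ∧ y ∈ U
  rel_meas := by
    have h : {p : X × X | R.rel p.1 p.2 ∧ p.1 ∈ U ∧ p.2 ∈ U} =
        {p : X × X | R.rel p.1 p.2} ∩ (Prod.fst ⁻¹' U ∩ Prod.snd ⁻¹' U) := by
      ext p
      simp only [Set.mem_setOf_eq, Set.mem_inter_iff, Set.mem_preimage, and_assoc]
    rw [h]
    exact R.rel_meas.inter ((measurable_fst hU).inter (measurable_snd hU))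
  rel_dom := fun h => ⟨⟨(R.rel_dom h.1).1, h.2.1⟩, ⟨(R.rel_dom h.1).2, h.2.2⟩⟩
  refl := fun x hx => ⟨R.refl x hx.1, hx.2, hx.2⟩
  symm := fun h => ⟨R.symm h.1, h.2.2, h.2.1⟩
  trans := fun h h' => ⟨R.trans h.1 h'.1, h.2.1, h'.2.2⟩
  countable_classes := fun x =>
    Set.Countable.mono (fun y hy => hy.1) (R.countable_classes x)

/-- `S` is a subrelation of `R`. -/
def CBER.IsSubrelOf {X : Type} [MeasurableSpace X] (S R : CBER X) : Prop :=
  S.dom ⊆ R.dom ∧ ∀ x y, S.rel x y → R.rel x y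

/-- A partial Borel isomorphism between Borel subsets `src` and `tgt` of `X`. -/
structure PBI (X : Type) [MeasurableSpace X] where
  src : Set X
  tgt : Set X
  src_meas : MeasurableSet src
  tgt_meas : MeasurableSet tgt
  toFun : X → X
  invFun : X → X
  meas_toFun : Measurable toFun
  meas_invFun : Measurable invFun
  mapsTo : Set.MapsTo toFun src tgt
  mapsTo_inv : Set.MapsTo invFun tgt src
  left_inv : ∀ x ∈ src, invFun (toFun x) = x
  right_inv : ∀ y ∈ tgt, toFun (invFun y) = y

/-- Membership in the full pseudogroup `[[R]]`: a partial Borel isomorphism whose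
graph is contained in `R`. -/
def CBER.InPseudogroup {X : Type} [MeasurableSpace X] (R : CBER X) (φ : PBI X) : Prop :=
  φ.src ⊆ R.dom ∧ ∀ x ∈ φ.src, R.rel x (φ.toFun x)

/-- Two subrelations `S₁`, `S₂` of `R` are inner conjugate in `R` if some element of the
full pseudogroup of `R` with domain `D(S₂)` and target `D(S₁)` conjugates one to the other. -/
def InnerConjugate {X : Type} [MeasurableSpace X] (R S₁ S₂ : CBER X) : Prop :=
  ∃ φ : PBI X, R.InPseudogroup φ ∧ φ.src = S₂.dom ∧ φ.tgt = S₁.dom ∧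
    ∀ x ∈ φ.src, ∀ y ∈ φ.src, (S₂.rel x y ↔ S₁.rel (φ.toFun x) (φ.toFun y))

/-- `R` preserves the measure `μ`: every element of its full pseudogroup preserves `μ`. -/
def CBER.IsPMP {X : Type} [MeasurableSpace X] (R : CBER X) (μ : Measure X) : Prop :=
  ∀ φ : PBI X, R.InPseudogroup φ → ∀ A : Set X, A ⊆ φ.src → MeasurableSet A →
    μ (φ.toFun '' A) = μ A

/-- Free independence of a family of equivalence relations: any cycle alternating
nontrivially among the factors must have two consecutive steps in the same factor. -/
def FreelyIndep {X : Type} [MeasurableSpace X] {ι : Type} (Rf : ι → CBER X) : Prop :=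
  ∀ (n : ℕ) (x : ℕ → X) (i : ℕ → ι), 2 ≤ n → x n = x 0 →
    (∀ j < n, x j ≠ x (j + 1)) → (∀ j < n, (Rf (i j)).rel (x j) (x (j + 1))) →
    ∃ j, j + 1 < n ∧ i j = i (j + 1)

/-- `R` is the free product of the family `Rf`: the family is freely independent and `R`
is the smallest equivalence relation on the union of the domains containing every `Rf i`. -/
def IsFreeProduct {X : Type} [MeasurableSpace X] {ι : Type} (R : CBER X)
    (Rf : ι → CBER X) : Prop :=
  FreelyIndep Rf ∧ R.dom = (⋃ i, (Rf i).dom) ∧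
    ∀ x y, R.rel x y ↔
      (x ∈ R.dom ∧ Relation.EqvGen (fun a b => ∃ i, (Rf i).rel a b) x y)

/-- The partition `U = ⊔ⱼ Uⱼ` trivializes the free product decomposition `R = *ⱼ Rf j`:
`U` is a complete section for `R`, the partition is `R|U`-invariant, and
`R|Uⱼ = (Rf j)|Uⱼ` for every `j`. -/
def Trivializes {X : Type} [MeasurableSpace X] {ι : Type}
    (R : CBER X) (Rf : ι → CBER X) (U : ι → Set X) : Prop :=
  (∀ j, MeasurableSet (U j)) ∧ (∀ j, U j ⊆ R.dom) ∧
  Pairwise (Function.onFun Disjoint U) ∧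
  (∀ x ∈ R.dom, ∃ y ∈ ⋃ j, U j, R.rel x y) ∧
  (∀ i j : ι, ∀ x ∈ U i, ∀ y ∈ U j, R.rel x y → i = j) ∧
  (∀ j, ∀ x ∈ U j, ∀ y ∈ U j, (R.rel x y ↔ (Rf j).rel x y))

/-- A free product decomposition is inessential if it admits a trivialization. -/
def Inessential {X : Type} [MeasurableSpace X] {ι : Type}
    (R : CBER X) (Rf : ι → CBER X) : Prop :=
  ∃ U : ι → Set X, Trivializes R Rf U

/-- Freely indecomposable (Borel context): every free product decomposition is inessential. -/
def FreelyIndecomposable {X : Type} [MeasurableSpace X] (R : CBER X) : Prop :=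
  ∀ (ι : Type) (_ : Countable ι) (Rf : ι → CBER X), IsFreeProduct R Rf → Inessential R Rf

/-- Inessential decomposition in the measured context: a trivialization up to `μ`-null sets. -/
def InessentialMod {X : Type} [MeasurableSpace X] (μ : Measure X) {ι : Type}
    (R : CBER X) (Rf : ι → CBER X) : Prop :=
  ∃ (U : ι → Set X) (C : Set X),
    (∀ j, MeasurableSet (U j)) ∧ (∀ j, U j ⊆ R.dom) ∧
    Pairwise (Function.onFun Disjoint U) ∧
    MeasurableSet C ∧ μ Cᶜ = 0 ∧
    (∀ x ∈ R.dom ∩ C, ∃ y ∈ ⋃ j, U j, R.rel x y) ∧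
    (∀ i j : ι, ∀ x ∈ U i ∩ C, ∀ y ∈ U j ∩ C, R.rel x y → i = j) ∧
    (∀ j, ∀ x ∈ U j ∩ C, ∀ y ∈ U j ∩ C, (R.rel x y ↔ (Rf j).rel x y))

/-- Freely indecomposable (measured context): every free product decomposition is
inessential up to `μ`-null sets. -/
def FreelyIndecomposableMod {X : Type} [MeasurableSpace X] (μ : Measure X)
    (R : CBER X) : Prop :=
  ∀ (ι : Type) (_ : Countable ι) (Rf : ι → CBER X), IsFreeProduct R Rf →
    InessentialMod μ R Rf

/-- One step of a word in a graphing: apply `φ` (if `e = true`) or `φ⁻¹` (if `e = false`). -/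
def PBIStep {X : Type} [MeasurableSpace X] (φ : PBI X) : Bool → X → X → Prop
  | true, a, b => a ∈ φ.src ∧ φ.toFun a = b
  | false, a, b => a ∈ φ.tgt ∧ φ.invFun a = b

/-- A treeing: any cyclic word in the generators and their inverses admits a reduction. -/
def IsTreeing {X : Type} [MeasurableSpace X] {ι : Type} (Φ : ι → PBI X) : Prop :=
  ∀ (n : ℕ) (i : ℕ → ι) (ε : ℕ → Bool) (x : ℕ → X),
    0 < n → x n = x 0 → (∀ j < n, PBIStep (Φ (i j)) (ε j) (x j) (x (j + 1))) →
    ∃ j, j + 1 < n ∧ i j = i (j + 1) ∧ ε j ≠ ε (j + 1)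

/-- The graphing `Φ` generates `R`: `R` is the smallest equivalence relation on the union of
the sources and targets containing the graphs of the `Φ i`. -/
def GeneratesCBER {X : Type} [MeasurableSpace X] {ι : Type} (Φ : ι → PBI X)
    (R : CBER X) : Prop :=
  R.dom = (⋃ i, ((Φ i).src ∪ (Φ i).tgt)) ∧ (∀ i, R.InPseudogroup (Φ i)) ∧
    ∀ x y, R.rel x y ↔ (x ∈ R.dom ∧
      Relation.EqvGen (fun a b => ∃ i, a ∈ (Φ i).src ∧ (Φ i).toFun a = b) x y)

/-- Treeable: generated by some (countable) treeing. -/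
def CBER.Treeable {X : Type} [MeasurableSpace X] (R : CBER X) : Prop :=
  ∃ Φ : ℕ → PBI X, IsTreeing Φ ∧ GeneratesCBER Φ R

/-- Hyperfinite: increasing union of finite Borel subrelations. -/
def CBER.Hyperfinite {X : Type} [MeasurableSpace X] (R : CBER X) : Prop :=
  ∃ S : ℕ → CBER X, (∀ n, (S n).IsSubrelOf R) ∧ (∀ n, (S n).FiniteClasses) ∧
    (∀ n, (S n).dom = R.dom) ∧ (∀ n, ∀ x y, (S n).rel x y → (S (n + 1)).rel x y) ∧
    ∀ x y, R.rel x y → ∃ n, (S n).rel x y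

/-- Ergodicity of a measured CBER: every invariant Borel set is null or conull. -/
def ErgodicCBER {X : Type} [MeasurableSpace X] (R : CBER X) (μ : Measure X) : Prop :=
  ∀ A : Set X, MeasurableSet A → (∀ x ∈ A, ∀ y, R.rel x y → y ∈ A) →
    μ A = 0 ∨ μ Aᶜ = 0

/-- A stable orbit equivalence between measured CBERs: a Borel isomorphism between
complete sections (mod null sets), sending the normalized measure to the normalized
measure, and preserving the relations a.e. -/
structure SOEquiv {X Y : Type} [MeasurableSpace X] [MeasurableSpace Y]
    (R : CBER X) (μ : Measure X) (S : CBER Y) (ν : Measure Y) where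
  A : Set X
  B : Set Y
  toFun : X → Y
  invFun : Y → X
  measA : MeasurableSet A
  measB : MeasurableSet B
  A_sub : A ⊆ R.dom
  B_sub : B ⊆ S.dom
  A_pos : 0 < μ A
  B_pos : 0 < ν B
  A_section : ∀ᵐ x ∂μ, x ∈ R.dom → ∃ y ∈ A, R.rel x y
  B_section : ∀ᵐ y ∂ν, y ∈ S.dom → ∃ z ∈ B, S.rel y z
  meas_toFun : Measurable toFun
  meas_invFun : Measurable invFun
  mapsTo : Set.MapsTo toFun A B
  mapsTo_inv : Set.MapsTo invFun B A
  left_inv : ∀ x ∈ A, invFun (toFun x) = x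
  right_inv : ∀ y ∈ B, toFun (invFun y) = y
  measure_eq : ∀ E : Set X, E ⊆ A → MeasurableSet E →
    (μ A)⁻¹ * μ E = (ν B)⁻¹ * ν (toFun '' E)
  rel_iff : ∃ C : Set X, MeasurableSet C ∧ μ (A \ C) = 0 ∧
    ∀ x ∈ A ∩ C, ∀ y ∈ A ∩ C, (R.rel x y ↔ S.rel (toFun x) (toFun y))

/-- Stable orbit equivalence. -/
def SOE {X Y : Type} [MeasurableSpace X] [MeasurableSpace Y]
    (R : CBER X) (μ : Measure X) (S : CBER Y) (ν : Measure Y) : Prop :=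
  Nonempty (SOEquiv R μ S ν)

/-- Orbit equivalence: a stable orbit equivalence where one can take the complete
sections to be the full spaces. -/
def OE {X Y : Type} [MeasurableSpace X] [MeasurableSpace Y]
    (R : CBER X) (μ : Measure X) (S : CBER Y) (ν : Measure Y) : Prop :=
  ∃ E : SOEquiv R μ S ν, E.A = Set.univ ∧ E.B = Set.univ

/-- A probability measure preserving action of a group `G` on a measured space. -/
structure PMPAction (G : Type) [Group G] (X : Type) [MeasurableSpace X]
    (μ : Measure X) where
  act : G → X → X
  act_one : ∀ x, act 1 x = x
  act_mul : ∀ g h x, act (g * h) x = act g (act h x)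
  measurePreserving : ∀ g, MeasurePreserving (act g) μ μ

/-- Essential freeness: a.e. point has trivial stabilizer. -/
def PMPAction.IsFree {G X : Type} [Group G] [MeasurableSpace X] {μ : Measure X}
    (α : PMPAction G X μ) : Prop :=
  ∀ᵐ x ∂μ, ∀ g : G, α.act g x = x → g = 1

/-- `R` is the orbit equivalence relation of the action `α` restricted to the subgroup `H`. -/
def IsOrbitRel {G X : Type} [Group G] [MeasurableSpace X] {μ : Measure X}
    (α : PMPAction G X μ) (H : Subgroup G) (R : CBER X) : Prop :=
  R.dom = Set.univ ∧ ∀ x y, (R.rel x y ↔ ∃ g ∈ H, α.act g x = y)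

/-- A countable group is measurably freely indecomposable (MFI) if the orbit equivalence
relation of every free p.m.p. action of it on a standard probability space is freely
indecomposable. -/
def MFI (G : Type) [Group G] [Countable G] : Prop :=
  ∀ (X : Type) [MeasurableSpace X] [StandardBorelSpace X]
    (μ : Measure X) [IsProbabilityMeasure μ]
    (α : PMPAction G X μ) (R : CBER X),
    α.IsFree → IsOrbitRel α ⊤ R → FreelyIndecomposableMod μ R

/-- `G` is the internal free product of the family of subgroups `H`. -/
def IsFreeProductOf (G : Type) [Group G] {ι : Type} (H : ι → Subgroup G) : Prop :=
  Function.Bijective (Monoid.CoprodI.lift fun i => (H i).subtype)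

/-- A Borel fundamental domain for an action, of the coupling kind: meets a.e. orbit,
and meets each orbit at most once mod null. -/
def IsFundamentalDomainFor {G : Type} [Group G] {Ω : Type} [MeasurableSpace Ω]
    (ν : Measure Ω) (a : G → Ω → Ω) (D : Set Ω) : Prop :=
  MeasurableSet D ∧ (∀ᵐ x ∂ν, ∃ g : G, a g x ∈ D) ∧
    ∀ g : G, g ≠ 1 → ν (D ∩ a g ⁻¹' D) = 0

/-- A measure equivalence coupling between `G` and `H`: a standard σ-finite measure space
with commuting measure-preserving essentially free actions of `G` and `H`, each admitting
a Borel fundamental domain of finite positive measure. -/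
structure MECoupling (G : Type) [Group G] (H : Type) [Group H] where
  (Ω : Type)
  [mΩ : MeasurableSpace Ω]
  [sbΩ : StandardBorelSpace Ω]
  (ν : Measure Ω)
  sigmaFinite : SigmaFinite ν
  aG : G → Ω → Ω
  aH : H → Ω → Ω
  DG : Set Ω
  DH : Set Ω
  aG_one : ∀ x, aG 1 x = x
  aG_mul : ∀ g g' x, aG (g * g') x = aG g (aG g' x)
  aH_one : ∀ x, aH 1 x = x
  aH_mul : ∀ h h' x, aH (h * h') x = aH h (aH h' x)
  comm : ∀ g h x, aG g (aH h x) = aH h (aG g x)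
  mp_aG : ∀ g, MeasurePreserving (aG g) ν ν
  mp_aH : ∀ h, MeasurePreserving (aH h) ν ν
  free_aG : ∀ᵐ x ∂ν, ∀ g, aG g x = x → g = 1
  free_aH : ∀ᵐ x ∂ν, ∀ h, aH h x = x → h = 1
  fund_DG : IsFundamentalDomainFor ν aG DG
  fund_DH : IsFundamentalDomainFor ν aH DH
  DG_pos : 0 < ν DG
  DG_fin : ν DG < ⊤
  DH_pos : 0 < ν DH
  DH_fin : ν DH < ⊤

/-- The generalized index (compression constant) of a measure equivalence coupling. -/
noncomputable def MECoupling.index {G : Type} [Group G] {H : Type} [Group H]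
    (c : MECoupling G H) : ENNReal :=
  c.ν c.DH / c.ν c.DG

/-- Measure equivalence of countable groups. -/
def MeasureEquivalent (G : Type) [Group G] (H : Type) [Group H] : Prop :=
  Nonempty (MECoupling G H)

/-- Measure equivalence with a prescribed generalized index. -/
def MEwithIndex (G : Type) [Group G] (H : Type) [Group H] (κ : ENNReal) : Prop :=
  ∃ c : MECoupling G H, c.index = κ

/-! ### Choosing least elements measurably -/

/-- An element satisfying `P` on which `key` is minimal. -/
noncomputable def pick {W : Type} [Nonempty W] (key : W → ℕ) (P : W → Prop) : W :=
  Classical.epsilon fun w => P w ∧ ∀ w', P w' → key w ≤ key w'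

theorem pick_spec {W : Type} [Nonempty W] {key : W → ℕ} {P : W → Prop} (h : ∃ w, P w) :
    P (pick key P) ∧ ∀ w', P w' → key (pick key P) ≤ key w' := by
  refine Classical.epsilon_spec (p := fun w => P w ∧ ∀ w', P w' → key w ≤ key w') ?_
  exact ⟨Function.argminOn key {w | P w} h, Function.argminOn_mem key {w | P w} h,
    fun w' hw' => Function.argminOn_le key {w | P w} hw'⟩

theorem pick_eq_iff {W : Type} [Nonempty W] {key : W → ℕ} {P : W → Prop}
    (hk : ∀ w w', P w → P w' → key w = key w' → w = w') (h : ∃ w, P w) (w : W) :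
    pick key P = w ↔ P w ∧ ∀ w', P w' → key w ≤ key w' := by
  constructor
  · rintro rfl
    exact pick_spec h
  · rintro ⟨h1, h2⟩
    exact hk _ _ (pick_spec h).1 h1
      (le_antisymm ((pick_spec h).2 _ h1) (h2 _ (pick_spec h).1))

theorem measurable_subst {X C : Type} [MeasurableSpace X] [Countable C] {f : X → C}
    (hf : ∀ c, Measurable fun x => f x = c) {Q : C → X → Prop} (hQ : ∀ c, Measurable (Q c)) :
    Measurable fun x => Q (f x) x := by
  have h : (fun x => Q (f x) x) = fun x => ∃ c, f x = c ∧ Q c x := by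
    funext x; simp
  rw [h]
  fun_prop

theorem measurable_pick {X W : Type} [MeasurableSpace X] [Nonempty W] [Countable W]
    {key : X → W → ℕ} {P : X → W → Prop}
    (hk : ∀ x w w', P x w → P x w' → key x w = key x w' → w = w')
    (hkey : ∀ w n, Measurable fun x => key x w = n)
    (hP : ∀ w, Measurable fun x => P x w) (w : W) {D : X → Prop} (hD : Measurable D)
    (h : ∀ x, D x → ∃ w, P x w) :
    Measurable fun x => D x ∧ pick (key x) (P x) = w := by
  have hle : ∀ w w', Measurable fun x => key x w ≤ key x w' := fun w w' =>
    measurable_subst (Q := fun n x => n ≤ key x w') (hkey w) fun n =>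
      measurable_subst (Q := fun m _ => n ≤ m) (hkey w') fun m => by fun_prop
  have e : (fun x => D x ∧ pick (key x) (P x) = w) =
      fun x => D x ∧ P x w ∧ ∀ w', P x w' → key x w ≤ key x w' := by
    funext x
    exact propext (and_congr_right fun hx => pick_eq_iff (hk x) (h x hx) w)
  rw [e]
  fun_prop

/-! ### Hypertrees and fields of hypertrees -/

/-- A family of equivalence relations on `V` whose classes form a hypertree: they connect `V`,
and every class `e` admits a projection `V → e` which is constant on all the other classes. -/
structure IsHypertree {V J : Type} (E : J → V → V → Prop) : Prop where
  equiv : ∀ j, Equivalence (E j)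
  proj : ∀ j v, ∃ pr : V → V, (∀ w, E j v w → pr w = w) ∧
    ∀ k w w', E k w w' → ¬(k = j ∧ E j v w) → pr w = pr w'
  connected : ∀ v w, Relation.EqvGen (fun a b => ∃ j, E j a b) v w

/-- A free action of `Γ` on `X`, lifted to a fibrewise action on `X × V` preserving the
relations `E j` on the fibres and admitting a Borel fundamental domain. -/
structure TreeField (Γ : Type) [Group Γ] {V J : Type} (E : J → V → V → Prop)
    (X : Type) [MeasurableSpace X] (μ : Measure X) extends PMPAction Γ X μ where
  free : ∀ g x, act g x = x → g = 1
  b : Γ → X → V → V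
  b_one : ∀ x v, b 1 x v = v
  b_mul : ∀ g h x v, b (g * h) x v = b g (act h x) (b h x v)
  b_meas : ∀ g v w, Measurable fun x => b g x v = w
  b_E : ∀ j v w g x, E j v w → E j (b g x v) (b g x w)
  F : V → Set X
  F_meas : ∀ v, MeasurableSet (F v)
  F_unique : ∀ x v, ∃! g, act g x ∈ F (b g x v)

section PMP

variable {Γ : Type} [Group Γ] {X : Type} [MeasurableSpace X] {μ : Measure X}

theorem PMPAction.measurable (α : PMPAction Γ X μ) (g : Γ) : Measurable (α.act g) :=
  (α.measurePreserving g).measurable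

theorem PMPAction.act_inv_act (α : PMPAction Γ X μ) (g : Γ) (x : X) :
    α.act g⁻¹ (α.act g x) = x := by
  rw [← α.act_mul, inv_mul_cancel, α.act_one]

theorem PMPAction.act_act_inv (α : PMPAction Γ X μ) (g : Γ) (x : X) :
    α.act g (α.act g⁻¹ x) = x := by
  rw [← α.act_mul, mul_inv_cancel, α.act_one]

theorem PMPAction.measure_preimage (α : PMPAction Γ X μ) (g : Γ) {A : Set X}
    (hA : MeasurableSet A) : μ (α.act g ⁻¹' A) = μ A :=
  (α.measurePreserving g).measure_preimage hA.nullMeasurableSet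

theorem PMPAction.ae_act (α : PMPAction Γ X μ) [Countable Γ] {p : X → Prop}
    (h : ∀ᵐ x ∂μ, p x) : ∀ᵐ x ∂μ, ∀ g, p (α.act g x) :=
  ae_all_iff.2 fun g => (α.measurePreserving g).quasiMeasurePreserving.ae h

end PMP

namespace TreeField

variable {Γ : Type} [Group Γ] {V J : Type} {E : J → V → V → Prop}
  {X : Type} [MeasurableSpace X] {μ : Measure X} (T : TreeField Γ E X μ)

theorem b_inv_b (g : Γ) (x : X) (v : V) : T.b g⁻¹ (T.act g x) (T.b g x v) = v := by
  rw [← T.b_mul, inv_mul_cancel, T.b_one]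

theorem b_b_inv (g : Γ) (x : X) (v : V) : T.b g x (T.b g⁻¹ (T.act g x) v) = v := by
  have h := T.b_inv_b g⁻¹ (T.act g x) v
  rwa [inv_inv, T.act_inv_act] at h

theorem b_injective (g : Γ) (x : X) : Function.Injective (T.b g x) :=
  Function.LeftInverse.injective (T.b_inv_b g x)

theorem b_surjective (g : Γ) (x : X) : Function.Surjective (T.b g x) :=
  fun w => ⟨_, T.b_b_inv g x w⟩

theorem b_E_iff (j : J) (g : Γ) (x : X) (v w : V) :
    E j (T.b g x v) (T.b g x w) ↔ E j v w := by
  refine ⟨fun h => ?_, T.b_E j v w g x⟩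
  simpa only [T.b_inv_b] using T.b_E j _ _ g⁻¹ (T.act g x) h

theorem act_eq_iff (g h : Γ) (x : X) : T.act g x = T.act h x ↔ g = h := by
  refine ⟨fun e => ?_, fun e => by rw [e]⟩
  have : T.act (h⁻¹ * g) x = x := by rw [T.act_mul, e, T.act_inv_act]
  exact (inv_mul_eq_one.1 (T.free _ _ this)).symm

/-- The group element moving `(x, v)` into the fundamental domain. -/
noncomputable def sg (x : X) (v : V) : Γ := (T.F_unique x v).choose

theorem sg_eq_iff (x : X) (v : V) (g : Γ) : T.sg x v = g ↔ T.act g x ∈ T.F (T.b g x v) :=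
  ⟨fun h => h ▸ (T.F_unique x v).choose_spec.1,
    fun h => ((T.F_unique x v).choose_spec.2 g h).symm⟩

theorem sg_act (h : Γ) (x : X) (v : V) : T.sg (T.act h x) (T.b h x v) * h = T.sg x v := by
  symm
  rw [T.sg_eq_iff, T.act_mul, T.b_mul]
  exact (T.sg_eq_iff _ _ _).1 rfl

theorem sg_meas [Countable V] (v : V) (g : Γ) : Measurable fun x => T.sg x v = g := by
  simp only [T.sg_eq_iff]
  refine measurable_subst (Q := fun w x => T.act g x ∈ T.F w) (T.b_meas g v) fun w => ?_
  exact measurable_mem.2 (T.toPMPAction.measurable g (T.F_meas w))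

/-- The points of the fibre at distance at most `n` from the orbit of `v₀`. -/
def level (v₀ : V) : ℕ → X → V → Prop
  | 0, x, v => ∃ g, T.b g x v = v₀
  | n + 1, x, v => level v₀ n x v ∨ ∃ w, (∃ j, E j v w) ∧ level v₀ n x w

theorem level_mono (v₀ : V) {m n : ℕ} (h : m ≤ n) {x : X} {v : V} (hv : T.level v₀ m x v) :
    T.level v₀ n x v := by
  induction n, h using Nat.le_induction with
  | base => exact hv
  | succ n _ ih => exact Or.inl ih

theorem level_act (v₀ : V) (n : ℕ) : ∀ (h : Γ) (x : X) (v : V),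
    T.level v₀ n x v → T.level v₀ n (T.act h x) (T.b h x v) := by
  induction n with
  | zero =>
    rintro h x v ⟨g, hg⟩
    exact ⟨g * h⁻¹, by rw [T.b_mul, T.b_inv_b, T.act_inv_act, hg]⟩
  | succ n ih =>
    rintro h x v (hv | ⟨w, ⟨j, hj⟩, hw⟩)
    · exact Or.inl (ih h x v hv)
    · exact Or.inr ⟨T.b h x w, ⟨j, T.b_E j _ _ h x hj⟩, ih h x w hw⟩

theorem level_act_iff (v₀ : V) (n : ℕ) (h : Γ) (x : X) (v : V) :
    T.level v₀ n (T.act h x) (T.b h x v) ↔ T.level v₀ n x v := by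
  refine ⟨fun H => ?_, T.level_act v₀ n h x v⟩
  simpa only [T.b_inv_b, T.act_inv_act] using T.level_act v₀ n h⁻¹ _ _ H

theorem level_meas [Countable Γ] [Countable V] (v₀ : V) (n : ℕ) :
    ∀ v, Measurable fun x => T.level v₀ n x v := by
  have hb := T.b_meas
  induction n with
  | zero => intro v; simp only [level]; fun_prop
  | succ n ih =>
    exact fun v => (ih v).or (Measurable.exists fun w => measurable_const.and (ih w))

theorem exists_level (hE : IsHypertree E) (v₀ : V) (x : X) (v : V) : ∃ n, T.level v₀ n x v := by
  have key : ∀ a c, Relation.EqvGen (fun a b => ∃ j, E j a b) a c →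
      ((∃ n, T.level v₀ n x a) ↔ ∃ n, T.level v₀ n x c) := by
    intro a c h
    induction h with
    | rel a c h =>
      obtain ⟨j, hj⟩ := h
      exact ⟨fun ⟨n, hn⟩ => ⟨n + 1, Or.inr ⟨a, ⟨j, (hE.equiv j).symm hj⟩, hn⟩⟩,
        fun ⟨n, hn⟩ => ⟨n + 1, Or.inr ⟨c, ⟨j, hj⟩, hn⟩⟩⟩
    | refl a => exact Iff.rfl
    | symm a c _ ih => exact ih.symm
    | trans a c d _ _ h1 h2 => exact h1.trans h2
  exact (key v₀ v (hE.connected _ _)).1 ⟨0, 1, T.b_one x v₀⟩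

section Choice

variable [Encodable V]

/-- An equivariantly chosen neighbour of `v` in the `n`-th level. -/
noncomputable def parent (v₀ : V) (n : ℕ) (x : X) (v : V) : V :=
  haveI : Nonempty V := ⟨v₀⟩
  pick (fun w => Encodable.encode (T.b (T.sg x v) x w))
    (fun w => (∃ j, E j v w) ∧ T.level v₀ n x w)

theorem parent_spec {v₀ : V} {n : ℕ} {x : X} {v : V} (h : ¬ T.level v₀ n x v)
    (h' : T.level v₀ (n + 1) x v) :
    (∃ j, E j v (T.parent v₀ n x v)) ∧ T.level v₀ n x (T.parent v₀ n x v) :=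
  haveI : Nonempty V := ⟨v₀⟩
  (pick_spec (h'.resolve_left h)).1

theorem parent_key_injective (x : X) (v : V) {w w' : V}
    (h : Encodable.encode (T.b (T.sg x v) x w) = Encodable.encode (T.b (T.sg x v) x w')) :
    w = w' :=
  T.b_injective _ _ (Encodable.encode_injective h)

theorem parent_act {v₀ : V} {n : ℕ} {x : X} {v : V} (h : ¬ T.level v₀ n x v)
    (h' : T.level v₀ (n + 1) x v) (g : Γ) :
    T.parent v₀ n (T.act g x) (T.b g x v) = T.b g x (T.parent v₀ n x v) := by
  have : Nonempty V := ⟨v₀⟩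
  have hs := pick_spec (key := fun w => Encodable.encode (T.b (T.sg x v) x w))
    (h'.resolve_left h)
  have hk : ∀ w, T.b (T.sg (T.act g x) (T.b g x v)) (T.act g x) (T.b g x w) =
      T.b (T.sg x v) x w := fun w => by rw [← T.b_mul, T.sg_act]
  have hsurj : ∀ w, ∃ u, T.b g x u = w := fun w => ⟨_, T.b_b_inv g x w⟩
  unfold parent
  rw [pick_eq_iff]
  · refine ⟨⟨?_, (T.level_act_iff v₀ n g x _).2 hs.1.2⟩, ?_⟩
    · obtain ⟨j, hj⟩ := hs.1.1
      exact ⟨j, T.b_E _ _ _ _ _ hj⟩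
    · intro w' hw'
      obtain ⟨u, rfl⟩ := hsurj w'
      rw [hk, hk]
      refine hs.2 u ⟨?_, (T.level_act_iff v₀ n g x _).1 hw'.2⟩
      obtain ⟨j, hj⟩ := hw'.1
      exact ⟨j, (T.b_E_iff _ _ _ _ _).1 hj⟩
  · intro w w' _ _ e
    exact T.parent_key_injective _ _ e
  · refine ⟨T.b g x (T.parent v₀ n x v), ?_, (T.level_act_iff v₀ n g x _).2 hs.1.2⟩
    obtain ⟨j, hj⟩ := hs.1.1
    exact ⟨j, T.b_E _ _ _ _ _ hj⟩

variable [Encodable Γ]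

/-- The retraction of the `n`-th level to the orbit, coded by an element of `Γ`. -/
noncomputable def retr (v₀ : V) : ℕ → X → V → Γ
  | 0, x, v => pick (fun g => Encodable.encode (g * (T.sg x v)⁻¹)) (fun g => T.b g x v = v₀)
  | n + 1, x, v => by
      classical
      exact if T.level v₀ n x v then retr v₀ n x v else retr v₀ n x (T.parent v₀ n x v)

theorem parent_meas (v₀ : V) (n : ℕ) (v w : V) :
    Measurable fun x => (¬ T.level v₀ n x v ∧ T.level v₀ (n + 1) x v) ∧
      T.parent v₀ n x v = w := by
  have : Nonempty V := ⟨v₀⟩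
  have hl := T.level_meas v₀
  refine measurable_pick (fun x _ _ _ _ e => T.parent_key_injective x v e) ?_ ?_ w
    (by fun_prop) fun x hx => hx.2.resolve_left hx.1
  · intro w m
    refine measurable_subst (Q := fun g x => Encodable.encode (T.b g x w) = m)
      (T.sg_meas v) fun g => ?_
    exact measurable_subst (Q := fun u _ => Encodable.encode u = m) (T.b_meas g w)
      fun u => by fun_prop
  · intro w
    fun_prop

theorem retr_succ_of_level {v₀ : V} {n : ℕ} {x : X} {v : V} (h : T.level v₀ n x v) :
    T.retr v₀ (n + 1) x v = T.retr v₀ n x v := by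
  simp only [retr, if_pos h]

theorem retr_succ_of_not_level {v₀ : V} {n : ℕ} {x : X} {v : V} (h : ¬ T.level v₀ n x v) :
    T.retr v₀ (n + 1) x v = T.retr v₀ n x (T.parent v₀ n x v) := by
  simp only [retr, if_neg h]

theorem retr_stable {v₀ : V} {m n : ℕ} (h : m ≤ n) {x : X} {v : V} (hv : T.level v₀ m x v) :
    T.retr v₀ n x v = T.retr v₀ m x v := by
  induction n, h using Nat.le_induction with
  | base => rfl
  | succ n hmn ih => rw [T.retr_succ_of_level (T.level_mono v₀ hmn hv), ih]

theorem retr_zero_spec {v₀ : V} {x : X} {v : V} (h : T.level v₀ 0 x v) :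
    T.b (T.retr v₀ 0 x v) x v = v₀ :=
  (pick_spec h).1

theorem retr_act (v₀ : V) (n : ℕ) : ∀ {x : X} {v : V}, T.level v₀ n x v → ∀ h : Γ,
    T.retr v₀ n (T.act h x) (T.b h x v) * h = T.retr v₀ n x v := by
  induction n with
  | zero =>
    intro x v hv h
    have hs := pick_spec (key := fun g => Encodable.encode (g * (T.sg x v)⁻¹)) hv
    rw [← eq_mul_inv_iff_mul_eq]
    simp only [retr]
    have hsg : T.sg (T.act h x) (T.b h x v) = T.sg x v * h⁻¹ :=
      eq_mul_inv_of_mul_eq (T.sg_act h x v)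
    have hP : ∀ g, T.b (g * h⁻¹) (T.act h x) (T.b h x v) = T.b g x v := fun g => by
      rw [← T.b_mul, inv_mul_cancel_right]
    rw [hsg, pick_eq_iff]
    · refine ⟨by rw [hP]; exact hs.1, fun g' hg' => ?_⟩
      have := hs.2 (g' * h) (by rw [T.b_mul]; exact hg')
      simpa [mul_assoc] using this
    · intro g g' _ _ e
      exact mul_right_cancel (Encodable.encode_injective e)
    · exact (T.level_act_iff v₀ 0 h x v).2 hv
  | succ n ih =>
    intro x v hv h
    by_cases hn : T.level v₀ n x v
    · rw [T.retr_succ_of_level hn, T.retr_succ_of_level ((T.level_act_iff v₀ n h x v).2 hn),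
        ih hn]
    · rw [T.retr_succ_of_not_level hn,
        T.retr_succ_of_not_level (fun H => hn ((T.level_act_iff v₀ n h x v).1 H)),
        T.parent_act hn hv, ih (T.parent_spec hn hv).2]

theorem retr_meas (v₀ : V) (n : ℕ) : ∀ (v : V) (g : Γ),
    Measurable fun x => T.level v₀ n x v ∧ T.retr v₀ n x v = g := by
  have hl := T.level_meas v₀
  induction n with
  | zero =>
    intro v g
    have hb := T.b_meas
    refine measurable_pick (key := fun x g => Encodable.encode (g * (T.sg x v)⁻¹))
      (fun x g g' _ _ e => mul_right_cancel (Encodable.encode_injective e))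
      ?_ ?_ g (hl 0 v) fun x hx => hx
    · intro g m
      exact measurable_subst (Q := fun s _ => Encodable.encode (g * s⁻¹) = m) (T.sg_meas v)
        fun s => by fun_prop
    · intro g; fun_prop
  | succ n ih =>
    intro v g
    have hp := T.parent_meas v₀ n v
    have e : (fun x => T.level v₀ (n + 1) x v ∧ T.retr v₀ (n + 1) x v = g) = fun x =>
        (T.level v₀ n x v ∧ T.retr v₀ n x v = g) ∨
        ∃ w, ((¬ T.level v₀ n x v ∧ T.level v₀ (n + 1) x v) ∧ T.parent v₀ n x v = w) ∧
          (T.level v₀ n x w ∧ T.retr v₀ n x w = g) := by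
      funext x
      apply propext
      by_cases hn : T.level v₀ n x v
      · simp [T.retr_succ_of_level hn, hn, T.level_mono v₀ (Nat.le_succ n) hn]
      · rw [T.retr_succ_of_not_level hn]
        constructor
        · rintro ⟨h1, h2⟩
          exact Or.inr ⟨_, ⟨⟨hn, h1⟩, rfl⟩, (T.parent_spec hn h1).2, h2⟩
        · rintro (h | ⟨w, ⟨⟨_, h1⟩, rfl⟩, _, h2⟩)
          · exact absurd h.1 hn
          · exact ⟨h1, h2⟩
    rw [e]
    exact (ih v g).or (Measurable.exists fun w => (hp w).and (ih w g))

end Choice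

/-- Every fibre retracts onto the orbit, equivariantly and measurably, with connected fibres. -/
theorem exists_retraction [Countable Γ] [Countable V] (hE : IsHypertree E) (v₀ : V) :
    ∃ p : X → V → Γ, (∀ v g, Measurable fun x => p x v = g) ∧
      (∀ x v h, p (T.act h x) (T.b h x v) * h = p x v) ∧
      ∀ (x : X) (Q : V → Prop), (∀ w, T.b (p x w) x w = v₀ → Q w) →
        (∀ j w w', E j w w' → p x w = p x w' → Q w' → Q w) → ∀ w, Q w := by
  classical
  let _ := Encodable.ofCountable Γ
  let _ := Encodable.ofCountable V
  have hlev := T.exists_level hE v₀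
  let p : X → V → Γ := fun x v => T.retr v₀ (Nat.find (hlev x v)) x v
  have hp : ∀ {n x v}, T.level v₀ n x v → p x v = T.retr v₀ n x v := fun {n x v} h =>
    (T.retr_stable (Nat.find_min' (hlev x v) h) (Nat.find_spec (hlev x v))).symm
  refine ⟨p, fun v g => ?_, fun x v h => ?_, fun x Q h0 hs => ?_⟩
  · have e : (fun x => p x v = g) = fun x => ∃ n, T.level v₀ n x v ∧ T.retr v₀ n x v = g := by
      funext x
      apply propext
      constructor
      · intro h
        obtain ⟨n, hn⟩ := hlev x v
        exact ⟨n, hn, (hp hn).symm.trans h⟩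
      · rintro ⟨n, hn, h⟩
        exact (hp hn).trans h
    rw [e]
    have := T.retr_meas v₀
    fun_prop
  · obtain ⟨n, hn⟩ := hlev x v
    rw [hp hn, hp (T.level_act v₀ n h x v hn), T.retr_act v₀ n hn]
  · have : ∀ n w, T.level v₀ n x w → Q w := by
      intro n
      induction n with
      | zero =>
        intro w hw
        exact h0 w (by rw [hp hw]; exact T.retr_zero_spec hw)
      | succ n ih =>
        intro w hw
        by_cases hn : T.level v₀ n x w
        · exact ih w hn
        · obtain ⟨⟨j, hj⟩, hl⟩ := T.parent_spec hn hw
          refine hs j w _ hj ?_ (ih _ hl)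
          rw [hp hw, hp hl, T.retr_succ_of_not_level hn]
    intro w
    obtain ⟨n, hn⟩ := hlev x w
    exact this n w hn

end TreeField

/-! ### Colouring a free transformation -/

/-- `n` is the first binary digit where `x` and `y` differ, and that digit of `x` is `n.2`. -/
def SeparatedAt {X : Type} [MeasurableSpace X] [MeasurableSpace.CountablyGenerated X]
    (x y : X) (n : ℕ × Bool) : Prop :=
  MeasurableSpace.mapNatBool X x n.1 = n.2 ∧ MeasurableSpace.mapNatBool X y n.1 ≠ n.2 ∧
    ∀ k < n.1, MeasurableSpace.mapNatBool X x k = MeasurableSpace.mapNatBool X y k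

section SeparatedAt

variable {X : Type} [MeasurableSpace X]

theorem exists_separatedAt [StandardBorelSpace X] {x y : X} (h : x ≠ y) :
    ∃ n, SeparatedAt x y n := by
  classical
  have h1 : ∃ n, MeasurableSpace.mapNatBool X x n ≠ MeasurableSpace.mapNatBool X y n := by
    by_contra hc
    push Not at hc
    exact h (MeasurableSpace.injective_mapNatBool X (funext hc))
  exact ⟨(Nat.find h1, MeasurableSpace.mapNatBool X x (Nat.find h1)), rfl,
    (Nat.find_spec h1).symm, fun k hk => not_not.1 (Nat.find_min h1 hk)⟩

variable [MeasurableSpace.CountablyGenerated X]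

theorem SeparatedAt.unique {x y : X} {m n : ℕ × Bool} (hm : SeparatedAt x y m)
    (hn : SeparatedAt x y n) : m = n := by
  have h : m.1 = n.1 := by
    rcases lt_trichotomy m.1 n.1 with h | h | h
    · exact absurd ((hn.2.2 _ h).symm.trans hm.1) hm.2.1
    · exact h
    · exact absurd ((hm.2.2 _ h).symm.trans hn.1) hn.2.1
  refine Prod.ext h ?_
  rw [← hm.1, ← hn.1, h]

theorem SeparatedAt.not_next {x y z : X} {n : ℕ × Bool} (h : SeparatedAt x y n) :
    ¬ SeparatedAt y z n :=
  fun h' => h.2.1 h'.1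

theorem measurable_separatedAt {f : X → X} (hf : Measurable f) (n : ℕ × Bool) :
    Measurable fun x => SeparatedAt x (f x) n := by
  have h1 : ∀ k, Measurable fun x => MeasurableSpace.mapNatBool X x k := fun k =>
    (measurable_pi_apply k).comp (MeasurableSpace.measurable_mapNatBool X)
  have h2 : ∀ k, Measurable fun x => MeasurableSpace.mapNatBool X (f x) k :=
    fun k => (h1 k).comp hf
  have e1 : Measurable fun x => MeasurableSpace.mapNatBool X x n.1 = n.2 :=
    measurable_mem.2 (measurableSet_eq_fun (h1 _) measurable_const)
  have e2 : Measurable fun x => MeasurableSpace.mapNatBool X (f x) n.1 = n.2 :=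
    measurable_mem.2 (measurableSet_eq_fun (h2 _) measurable_const)
  have e3 : ∀ k, Measurable fun x =>
      MeasurableSpace.mapNatBool X x k = MeasurableSpace.mapNatBool X (f x) k :=
    fun k => measurable_mem.2 (measurableSet_eq_fun (h1 _) (h2 _))
  unfold SeparatedAt
  fun_prop

end SeparatedAt

/-! ### Free independence from projections -/

/-- A family of relations is freely independent as soon as every class admits a map which is
injective on it and constant on all the other classes. -/
theorem no_reduced_cycle {X K : Type} (R : K → X → X → Prop) (hR : ∀ k, Equivalence (R k))
    (H : ∀ k x, ∃ (A : Type) (f : X → A), (∀ y z, R k x y → R k x z → f y = f z → y = z) ∧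
      ∀ l y z, R l y z → ¬ (l = k ∧ R k x y) → f y = f z) :
    ∀ (n : ℕ) (x : ℕ → X) (i : ℕ → K), 2 ≤ n → x n = x 0 → (∀ j < n, x j ≠ x (j + 1)) →
      (∀ j < n, R (i j) (x j) (x (j + 1))) → ∃ j, j + 1 < n ∧ i j = i (j + 1) := by
  classical
  intro n
  induction n using Nat.strong_induction_on with
  | _ n ih =>
    intro x i hn hx hne hrel
    by_contra hc
    push Not at hc
    obtain ⟨A, f, hinj, hconst⟩ := H (i 0) (x 0)
    have h01 : R (i 0) (x 0) (x 1) := hrel 0 (by omega)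
    have key : ∀ k, 1 ≤ k → k ≤ n →
        (∀ m, 1 ≤ m → m < k → ¬ (i m = i 0 ∧ R (i 0) (x 0) (x m))) → f (x 1) = f (x k) := by
      intro k hk
      induction k, hk using Nat.le_induction with
      | base => intros; rfl
      | succ k hk ihk =>
        intro hkn hm
        rw [ihk (by omega) fun m h1 h2 => hm m h1 (by omega)]
        exact hconst _ _ _ (hrel k (by omega)) (hm k hk (by omega))
    have hex : ∃ k, 1 ≤ k ∧ k < n ∧ (i k = i 0 ∧ R (i 0) (x 0) (x k)) := by
      by_contra hno
      push Not at hno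
      have := key n (by omega) le_rfl fun m h1 h2 h3 => hno m h1 h2 h3.1 h3.2
      rw [hx] at this
      exact hne 0 (by omega) (hinj _ _ h01 ((hR _).refl _) this).symm
    obtain ⟨h1, h2, h3, h4⟩ := Nat.find_spec hex
    set k := Nat.find hex
    have hmin : ∀ m, 1 ≤ m → m < k → ¬ (i m = i 0 ∧ R (i 0) (x 0) (x m)) :=
      fun m hm hmk h => Nat.find_min hex hmk ⟨hm, by omega, h⟩
    have hxk : x 1 = x k := hinj _ _ h01 h4 (key k h1 h2.le hmin)
    have hk1 : k ≠ 1 := fun e => hc 0 (by omega) (by rw [← h3, e])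
    have hk2 : k ≠ 2 := fun e => hne 1 (by omega) (by rw [hxk, e])
    obtain ⟨j, hj, hj'⟩ := ih (k - 1) (by omega) (fun m => x (m + 1)) (fun m => i (m + 1))
      (by omega) (by simp only [Nat.sub_add_cancel h1]; rw [hxk])
      (fun j hj => hne _ (by omega)) (fun j hj => hrel _ (by omega))
    exact hc (j + 1) (by omega) hj'

/-! ### Sets with boundedly many returns -/

theorem PMPAction.measure_eq_zero_of_finite_returns {Γ X : Type} [Group Γ] [Infinite Γ]
    [MeasurableSpace X] {μ : Measure X} [IsFiniteMeasure μ] (α : PMPAction Γ X μ)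
    {A : Set X} (hA : MeasurableSet A) (S : Finset Γ)
    (hS : ∀ x ∈ A, ∀ g, α.act g x ∈ A → g ∈ S) : μ A = 0 := by
  classical
  have hbound : ∀ n : ℕ, n * μ A ≤ S.card * μ Set.univ := by
    intro n
    obtain ⟨t, rfl⟩ := Infinite.exists_subset_card_eq Γ n
    calc (t.card : ENNReal) * μ A = ∑ g ∈ t, μ (α.act g ⁻¹' A) := by
          simp [α.measure_preimage _ hA]
      _ = ∑ g ∈ t, ∫⁻ x, (α.act g ⁻¹' A).indicator 1 x ∂μ := by
          refine Finset.sum_congr rfl fun g _ => ?_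
          rw [lintegral_indicator_one (α.measurable g hA)]
      _ = ∫⁻ x, ∑ g ∈ t, (α.act g ⁻¹' A).indicator 1 x ∂μ := by
          rw [lintegral_finsetSum]
          exact fun g _ => measurable_one.indicator (α.measurable g hA)
      _ ≤ ∫⁻ _, (S.card : ENNReal) ∂μ := by
          refine lintegral_mono fun x => ?_
          have : ∑ g ∈ t, (α.act g ⁻¹' A).indicator (1 : X → ENNReal) x =
              ((t.filter fun g => α.act g x ∈ A).card : ENNReal) := by
            simp [Set.indicator_apply]
          rw [this, Nat.cast_le]
          rcases (t.filter fun g => α.act g x ∈ A).eq_empty_or_nonempty with h | ⟨g₀, h₀⟩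
          · simp [h]
          · refine Finset.card_le_card_of_injOn (fun g => g * g₀⁻¹) (fun g hg => ?_)
              fun g _ g' _ e => mul_right_cancel e
            simp only [Finset.coe_filter, Set.mem_ofPred_eq, Finset.mem_filter] at hg h₀
            refine hS _ h₀.2 _ ?_
            rw [← α.act_mul, inv_mul_cancel_right]
            exact hg.2
      _ = S.card * μ Set.univ := by simp
  by_contra h0
  have htop : S.card * μ Set.univ ≠ ⊤ :=
    ENNReal.mul_ne_top (ENNReal.natCast_ne_top _) (measure_ne_top _ _)
  obtain ⟨n, hn⟩ := ENNReal.exists_nat_mul_gt h0 htop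
  exact absurd (hbound n) (not_le.2 hn)

set_option linter.unusedSectionVars false

/-! ### The free product decomposition attached to a field of hypertrees -/

namespace TreeField

/-- An equivariant retraction of the fibres onto the orbit of `v₀`. -/
structure Retraction {Γ : Type} [Group Γ] {V J : Type} {E : J → V → V → Prop}
    {X : Type} [MeasurableSpace X] {μ : Measure X} (T : TreeField Γ E X μ) (v₀ : V) where
  p : X → V → Γ
  p_meas : ∀ v g, Measurable fun x => p x v = g
  p_act : ∀ x v h, p (T.act h x) (T.b h x v) * h = p x v
  p_induction : ∀ (x : X) (Q : V → Prop), (∀ w, T.b (p x w) x w = v₀ → Q w) →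
    (∀ j w w', E j w w' → p x w = p x w' → Q w' → Q w) → ∀ w, Q w

namespace Retraction

variable {Γ : Type} [Group Γ] {V J : Type} {E : J → V → V → Prop}
  {X : Type} [MeasurableSpace X] {μ : Measure X} {T : TreeField Γ E X μ} {v₀ : V}
  (r : T.Retraction v₀)

theorem p_act_eq (x : X) (v : V) (h : Γ) (g : Γ) :
    r.p (T.act h x) (T.b h x v) = g ↔ r.p x v = g * h := by
  rw [← r.p_act x v h, mul_left_inj]

theorem p_base (x : X) (g : Γ) :
    r.p x (T.b g⁻¹ (T.act g x) v₀) = r.p (T.act g x) v₀ * g := by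
  rw [← r.p_act x _ g, T.b_b_inv]

theorem p_p (x : X) (w : V) : r.p x (T.b (r.p x w)⁻¹ (T.act (r.p x w) x) v₀) = r.p x w := by
  refine r.p_induction x
    (fun w => r.p x (T.b (r.p x w)⁻¹ (T.act (r.p x w) x) v₀) = r.p x w) ?_ ?_ w
  · intro w hw
    have e := T.b_inv_b (r.p x w) x w
    rw [hw] at e
    simp only [e]
  · intro j w w' _ h hw'
    rw [h, hw']

theorem p_proj (x : X) {j : J} {v : V} {pr : V → V} (h1 : ∀ w, E j v w → pr w = w)
    (h2 : ∀ k w w', E k w w' → ¬(k = j ∧ E j v w) → pr w = pr w') (hE : IsHypertree E) (w : V) :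
    r.p x (pr (T.b (r.p x w)⁻¹ (T.act (r.p x w) x) v₀)) = r.p x (pr w) := by
  refine r.p_induction x
    (fun w => r.p x (pr (T.b (r.p x w)⁻¹ (T.act (r.p x w) x) v₀)) = r.p x (pr w)) ?_ ?_ w
  · intro w hw
    have e := T.b_inv_b (r.p x w) x w
    rw [hw] at e
    simp only [e]
  · intro k w w' hww h hw'
    rw [h, hw']
    by_cases hc : k = j ∧ E j v w
    · obtain ⟨rfl, hvw⟩ := hc
      rw [h1 _ hvw, h1 _ ((hE.equiv k).trans hvw hww), h]
    · rw [h2 k w w' hww hc]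

/-- The vertex over the orbit representative of `w`; it is invariant under `Γ`. -/
def type (x : X) (w : V) : V := T.b (r.p x w) x w

theorem type_act (h : Γ) (x : X) (w : V) : r.type (T.act h x) (T.b h x w) = r.type x w := by
  rw [type, ← T.b_mul, r.p_act, type]

theorem eq_of_type_eq {x : X} {w w' : V} (h : r.p x w = r.p x w')
    (h' : r.type x w = r.type x w') : w = w' := by
  unfold type at h'
  rw [h] at h'
  exact T.b_injective _ _ h'

theorem type_meas [Countable Γ] (w u : V) : Measurable fun x => r.type x w = u :=
  measurable_subst (Q := fun g x => T.b g x w = u) (r.p_meas w) fun g => T.b_meas g w u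

variable [Encodable V] [Encodable Γ]

/-- `w` has the least type in its `E j`-class. -/
def IsMin (j : J) (x : X) (w : V) : Prop :=
  ∀ w', E j w w' → Encodable.encode (r.type x w) ≤ Encodable.encode (r.type x w')

theorem isMin_act (j : J) (h : Γ) (x : X) (w : V) :
    r.IsMin j (T.act h x) (T.b h x w) ↔ r.IsMin j x w := by
  unfold IsMin
  rw [(T.b_surjective h x).forall]
  simp only [T.b_E_iff, r.type_act]

theorem le_meas (w w' : V) : Measurable fun x =>
    Encodable.encode (r.type x w) ≤ Encodable.encode (r.type x w') :=
  measurable_subst (Q := fun u x => Encodable.encode u ≤ Encodable.encode (r.type x w'))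
    (r.type_meas w) fun u => measurable_subst
      (Q := fun u' _ => Encodable.encode u ≤ Encodable.encode u') (r.type_meas w')
      fun u' => by fun_prop

theorem isMin_meas (j : J) (w : V) : Measurable fun x => r.IsMin j x w := by
  have := r.le_meas
  unfold IsMin
  fun_prop

/-- Left multiplication by `a` moves the representative of `w` to that of a vertex of
least type in the `E j`-class of `w`. -/
def Reach (j : J) (x : X) (w : V) (a : Γ) : Prop :=
  ∃ w', E j w w' ∧ r.IsMin j x w' ∧ r.p x w' = a * r.p x w

theorem reach_act (j : J) (h : Γ) (x : X) (w : V) (a : Γ) :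
    r.Reach j (T.act h x) (T.b h x w) a ↔ r.Reach j x w a := by
  unfold Reach
  rw [(T.b_surjective h x).exists]
  simp only [T.b_E_iff, r.isMin_act, r.p_act_eq, mul_assoc, r.p_act]

theorem exists_reach (hE : IsHypertree E) (j : J) (x : X) (w : V) : ∃ a, r.Reach j x w a := by
  have : Nonempty V := ⟨v₀⟩
  obtain ⟨h1, h2⟩ := pick_spec (key := fun w => Encodable.encode (r.type x w))
    (P := fun w' => E j w w') ⟨w, (hE.equiv j).refl w⟩
  exact ⟨_, _, h1, fun w'' hw => h2 w'' ((hE.equiv j).trans h1 hw),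
    (inv_mul_cancel_right _ _).symm⟩

theorem reach_meas (j : J) (w : V) (a : Γ) : Measurable fun x => r.Reach j x w a := by
  have h1 := r.isMin_meas j
  have h2 : ∀ w', Measurable fun x => r.p x w' = a * r.p x w := fun w' =>
    measurable_subst (Q := fun g x => r.p x w' = a * g) (r.p_meas w) fun g => r.p_meas w' _
  unfold Reach
  fun_prop

open Classical in
/-- An enumeration of `Γ` starting with the identity. -/
noncomputable def key (a : Γ) : ℕ := if a = 1 then 0 else Encodable.encode a + 1

theorem key_injective : Function.Injective (key : Γ → ℕ) := by
  intro a b h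
  unfold key at h
  split_ifs at h with h1 h2 h2
  · rw [h1, h2]
  · exact Encodable.encode_injective (by omega)

/-- The first element in `Reach`. -/
def Shift (j : J) (x : X) (w : V) (a : Γ) : Prop :=
  r.Reach j x w a ∧ ∀ a', r.Reach j x w a' → key a ≤ key a'

theorem shift_act (j : J) (h : Γ) (x : X) (w : V) (a : Γ) :
    r.Shift j (T.act h x) (T.b h x w) a ↔ r.Shift j x w a := by
  simp only [Shift, r.reach_act]

theorem exists_shift (hE : IsHypertree E) (j : J) (x : X) (w : V) : ∃ a, r.Shift j x w a :=
  ⟨_, pick_spec (key := key) (r.exists_reach hE j x w)⟩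

theorem Shift.unique {r : T.Retraction v₀} {j : J} {x : X} {w : V} {a a' : Γ}
    (h : r.Shift j x w a) (h' : r.Shift j x w a') : a = a' :=
  key_injective (le_antisymm (h.2 _ h'.1) (h'.2 _ h.1))

theorem reach_congr (hE : IsHypertree E) {j : J} {x : X} {w w' : V} (hw : E j w w')
    (hp : r.p x w = r.p x w') (a : Γ) : r.Reach j x w a ↔ r.Reach j x w' a := by
  unfold Reach
  rw [hp]
  exact exists_congr fun u => and_congr_left' ⟨(hE.equiv j).trans ((hE.equiv j).symm hw),
    (hE.equiv j).trans hw⟩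

theorem shift_congr (hE : IsHypertree E) {j : J} {x : X} {w w' : V} (hw : E j w w')
    (hp : r.p x w = r.p x w') (a : Γ) : r.Shift j x w a ↔ r.Shift j x w' a := by
  simp only [Shift, r.reach_congr hE hw hp]

theorem shift_one_iff {j : J} {x : X} {w : V} : r.Shift j x w 1 ↔ r.Reach j x w 1 :=
  ⟨fun h => h.1, fun h => ⟨h, fun a' _ => by simp [key]⟩⟩

theorem shift_meas (j : J) (w : V) (a : Γ) : Measurable fun x => r.Shift j x w a := by
  have := r.reach_meas j w
  unfold Shift
  fun_prop

variable [MeasurableSpace.CountablyGenerated X]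

/-- Where the edges from the class of `w` to the vertices of least type start. -/
def StarDom (j : J) (u : V) (a : Γ) (n : ℕ × Bool) (x : X) (g : Γ) : Prop :=
  a ≠ 1 ∧ SeparatedAt (T.act g x) (T.act a (T.act g x)) n ∧
    ∃ w, r.p x w = g ∧ r.type x w = u ∧ r.Shift j x w a ∧
      ∀ w', E j w w' → r.p x w' = g →
        Encodable.encode (r.type x w) ≤ Encodable.encode (r.type x w')

/-- Where the edges from an orbit point to its representative start. -/
def RepDom (a : Γ) (n : ℕ × Bool) (x : X) (g : Γ) : Prop :=
  a ≠ 1 ∧ SeparatedAt (T.act g x) (T.act a (T.act g x)) n ∧ r.p (T.act g x) v₀ = a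

theorem starDom_act (j : J) (u : V) (a : Γ) (n : ℕ × Bool) (h : Γ) (x : X) (g : Γ) :
    r.StarDom j u a n (T.act h x) g ↔ r.StarDom j u a n x (g * h) := by
  unfold StarDom
  rw [T.act_mul, (T.b_surjective h x).exists]
  refine and_congr_right' (and_congr_right' (exists_congr fun w => ?_))
  rw [(T.b_surjective h x).forall]
  simp only [T.b_E_iff, r.type_act, r.p_act_eq, r.shift_act]

theorem repDom_act (a : Γ) (n : ℕ × Bool) (h : Γ) (x : X) (g : Γ) :
    r.RepDom a n (T.act h x) g ↔ r.RepDom a n x (g * h) := by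
  simp only [RepDom, T.act_mul]

theorem starDom_meas (j : J) (u : V) (a : Γ) (n : ℕ × Bool) (g : Γ) :
    Measurable fun x => r.StarDom j u a n x g := by
  have h1 := r.p_meas
  have h2 := r.type_meas
  have h3 := r.shift_meas
  have h4 := r.le_meas
  have h5 : Measurable fun x => SeparatedAt (T.act g x) (T.act a (T.act g x)) n :=
    (measurable_separatedAt (T.toPMPAction.measurable a) n).comp (T.toPMPAction.measurable g)
  unfold StarDom
  fun_prop

theorem repDom_meas (a : Γ) (n : ℕ × Bool) (g : Γ) : Measurable fun x => r.RepDom a n x g := by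
  have h5 : Measurable fun x => SeparatedAt (T.act g x) (T.act a (T.act g x)) n :=
    (measurable_separatedAt (T.toPMPAction.measurable a) n).comp (T.toPMPAction.measurable g)
  have h6 : Measurable fun x => r.p (T.act g x) v₀ = a :=
    (r.p_meas v₀ a).comp (T.toPMPAction.measurable g)
  unfold RepDom
  fun_prop

/-- The relation joining `g` to `a * g` for every `g` in `D`. -/
def Arrow (D : Γ → Prop) (a g g' : Γ) : Prop :=
  g = g' ∨ (D g ∧ g' = a * g) ∨ (D g' ∧ g = a * g')

/-- The vertices of type `u` representing `g` and `g'` are in the same `E j`-class, in which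
`u` is the least type. -/
def Stab (j : J) (u : V) (x : X) (g g' : Γ) : Prop :=
  ∃ w w', E j w w' ∧ r.IsMin j x w ∧ r.type x w = u ∧ r.type x w' = u ∧
    r.p x w = g ∧ r.p x w' = g'

/-- The index set of the decomposition. -/
abbrev Index (Γ V J : Type) : Type :=
  (J × V) ⊕ (J × V × Γ × (ℕ × Bool)) ⊕ (Γ × (ℕ × Bool))

/-- The factors of the decomposition, read on the orbit of `x`. -/
def Factor : Index Γ V J → X → Γ → Γ → Prop
  | .inl (j, u), x, g, g' => g = g' ∨ r.Stab j u x g g'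
  | .inr (.inl (j, u, a, n)), x, g, g' => Arrow (r.StarDom j u a n x) a g g'
  | .inr (.inr (a, n)), x, g, g' => Arrow (r.RepDom a n x) a g g'

theorem Arrow.equivalence {D : Γ → Prop} {a : Γ} (h : ∀ g, D g → ¬ D (a * g)) :
    Equivalence (Arrow D a) where
  refl g := Or.inl rfl
  symm := by
    rintro g g' (h | h | h)
    · exact Or.inl h.symm
    · exact Or.inr (Or.inr h)
    · exact Or.inr (Or.inl h)
  trans := by
    rintro g g' g'' (rfl | ⟨h1, rfl⟩ | ⟨h1, rfl⟩) (h' | ⟨h2, h3⟩ | ⟨h2, h3⟩)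
    · exact Or.inl h'
    · exact Or.inr (Or.inl ⟨h2, h3⟩)
    · exact Or.inr (Or.inr ⟨h2, h3⟩)
    · exact h' ▸ Or.inr (Or.inl ⟨h1, rfl⟩)
    · exact absurd h2 (h _ h1)
    · exact Or.inl (mul_left_cancel h3)
    · exact h' ▸ Or.inr (Or.inr ⟨h1, rfl⟩)
    · exact Or.inl h3.symm
    · exact absurd (h3 ▸ h1) (h _ h2)

theorem Stab.symm {r : T.Retraction v₀} (hE : IsHypertree E) {j : J} {u : V} {x : X} {g g' : Γ}
    (h : r.Stab j u x g g') : r.Stab j u x g' g := by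
  obtain ⟨w, w', h1, h2, h3, h4, h5, h6⟩ := h
  refine ⟨w', w, (hE.equiv j).symm h1, fun w'' hw => ?_, h4, h3, h6, h5⟩
  rw [h4, ← h3]
  exact h2 _ ((hE.equiv j).trans h1 hw)

theorem Stab.trans {r : T.Retraction v₀} (hE : IsHypertree E) {j : J} {u : V} {x : X}
    {g g' g'' : Γ} (h : r.Stab j u x g g') (h' : r.Stab j u x g' g'') : r.Stab j u x g g'' := by
  obtain ⟨w, w', h1, h2, h3, h4, h5, h6⟩ := h
  obtain ⟨z, z', k1, k2, k3, k4, k5, k6⟩ := h'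
  have : w' = z := r.eq_of_type_eq (h6.trans k5.symm) (h4.trans k3.symm)
  subst this
  exact ⟨w, z', (hE.equiv j).trans h1 k1, h2, h3, k4, h5, k6⟩

theorem factor_equivalence (hE : IsHypertree E) (k : Index Γ V J) (x : X) :
    Equivalence (r.Factor k x) := by
  rcases k with ⟨j, u⟩ | ⟨j, u, a, n⟩ | ⟨a, n⟩
  · refine ⟨fun g => Or.inl rfl, ?_, ?_⟩
    · rintro g g' (h | h)
      · exact Or.inl h.symm
      · exact Or.inr (h.symm hE)
    · rintro g g' g'' (rfl | h) (h' | h')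
      · exact Or.inl h'
      · exact Or.inr h'
      · exact Or.inr (h' ▸ h)
      · exact Or.inr (h.trans hE h')
  · refine Arrow.equivalence fun g h h' => ?_
    have := h'.2.1
    rw [T.act_mul] at this
    exact h.2.1.not_next this
  · refine Arrow.equivalence fun g h h' => ?_
    have := h'.2.1
    rw [T.act_mul] at this
    exact h.2.1.not_next this

theorem factor_act (k : Index Γ V J) (h : Γ) (x : X) (g g' : Γ) :
    r.Factor k (T.act h x) g g' ↔ r.Factor k x (g * h) (g' * h) := by
  rcases k with ⟨j, u⟩ | ⟨j, u, a, n⟩ | ⟨a, n⟩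
  · simp only [Factor, Stab, mul_left_inj]
    rw [(T.b_surjective h x).exists]
    refine or_congr_right (exists_congr fun w => ?_)
    rw [(T.b_surjective h x).exists]
    simp only [T.b_E_iff, r.type_act, r.p_act_eq, r.isMin_act]
  · simp only [Factor, Arrow, r.starDom_act, ← mul_assoc, mul_left_inj]
  · simp only [Factor, Arrow, r.repDom_act, ← mul_assoc, mul_left_inj]

theorem factor_meas (k : Index Γ V J) (g g' : Γ) : Measurable fun x => r.Factor k x g g' := by
  rcases k with ⟨j, u⟩ | ⟨j, u, a, n⟩ | ⟨a, n⟩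
  · have h1 := r.p_meas
    have h2 := r.type_meas
    have h3 := r.isMin_meas
    simp only [Factor, Stab]
    fun_prop
  · have := r.starDom_meas j u a n
    simp only [Factor, Arrow]
    fun_prop
  · have := r.repDom_meas a n
    simp only [Factor, Arrow]
    fun_prop

end Retraction

end TreeField

set_option linter.unusedSectionVars false

namespace TreeField.Retraction

variable {Γ : Type} [Group Γ] {V J : Type} {E : J → V → V → Prop}
  {X : Type} [MeasurableSpace X] {μ : Measure X} {T : TreeField Γ E X μ} {v₀ : V}
  (r : T.Retraction v₀) [Encodable V] [Encodable Γ]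

theorem IsMin.type_eq {r : T.Retraction v₀} (hE : IsHypertree E) {j : J} {x : X} {w w' : V}
    (h : r.IsMin j x w) (h' : r.IsMin j x w') (hw : E j w w') : r.type x w = r.type x w' :=
  Encodable.encode_injective (le_antisymm (h _ hw) (h' _ ((hE.equiv j).symm hw)))

variable [MeasurableSpace.CountablyGenerated X]

theorem StarDom.exists_edge {r : T.Retraction v₀} {j : J} {u : V} {a : Γ} {n : ℕ × Bool}
    {x : X} {g : Γ} (h : r.StarDom j u a n x g) :
    ∃ w w', E j w w' ∧ r.p x w = g ∧ r.p x w' = a * g ∧ r.IsMin j x w' ∧ r.type x w = u ∧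
      r.Shift j x w a ∧ ∀ w', E j w w' → r.p x w' = g →
        Encodable.encode (r.type x w) ≤ Encodable.encode (r.type x w') := by
  obtain ⟨-, -, w, h1, h2, h3, h4⟩ := h
  obtain ⟨w', k1, k2, k3⟩ := h3.1
  exact ⟨w, w', k1, h1, k3.trans (by rw [h1]), k2, h2, h3, h4⟩

theorem RepDom.p_base {r : T.Retraction v₀} {a : Γ} {n : ℕ × Bool} {x : X} {g : Γ}
    (h : r.RepDom a n x g) : r.p x (T.b g⁻¹ (T.act g x) v₀) = a * g := by
  rw [r.p_base, h.2.2]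

/-- It suffices to collapse every factor along its generating edges. -/
theorem collapse_of {x : X} {C : Index Γ V J → Γ → Prop}
    (hC : ∀ l y z, r.Factor l x y z → C l z → C l y) {A : Type} {f : Γ → A}
    (h1 : ∀ j u y z, r.Stab j u x y z → ¬ C (.inl (j, u)) y → f y = f z)
    (h2 : ∀ j u a n y, r.StarDom j u a n x y → ¬ C (.inr (.inl (j, u, a, n))) y →
      f y = f (a * y))
    (h3 : ∀ a n y, r.RepDom a n x y → ¬ C (.inr (.inr (a, n))) y → f y = f (a * y))
    (l : Index Γ V J) (y z : Γ) (h : r.Factor l x y z) (hl : ¬ C l y) : f y = f z := by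
  have hz : ¬ C l z := fun h' => hl (hC l y z h h')
  rcases l with ⟨j, u⟩ | ⟨j, u, a, n⟩ | ⟨a, n⟩
  · rcases h with rfl | h
    · rfl
    · exact h1 j u y z h hl
  · rcases h with rfl | ⟨h, rfl⟩ | ⟨h, rfl⟩
    · rfl
    · exact h2 j u a n y h hl
    · exact (h2 j u a n z h hz).symm
  · rcases h with rfl | ⟨h, rfl⟩ | ⟨h, rfl⟩
    · rfl
    · exact h3 a n y h hl
    · exact (h3 a n z h hz).symm

theorem Arrow.exists_source {D : Γ → Prop} {a g₀ y₀ : Γ} (h : ∀ g, D g → ¬ D (a * g))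
    (h₀ : Arrow D a g₀ y₀) (hne : y₀ ≠ g₀) : ∃ s, D s ∧ Arrow D a g₀ s ∧
      ∀ y, Arrow D a g₀ y → y = s ∨ y = a * s := by
  have hs : ∃ s, D s ∧ Arrow D a g₀ s := by
    rcases h₀ with h₀ | h₀ | h₀
    · exact absurd h₀.symm hne
    · exact ⟨g₀, h₀.1, Or.inl rfl⟩
    · exact ⟨y₀, h₀.1, Or.inr (Or.inr h₀)⟩
  obtain ⟨s, h1, h2⟩ := hs
  refine ⟨s, h1, h2, fun y hy => ?_⟩
  rcases (Arrow.equivalence h).trans ((Arrow.equivalence h).symm h2) hy with e | e | e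
  · exact Or.inl e.symm
  · exact Or.inr e.2
  · exact absurd (e.2 ▸ h1) (h _ e.1)

theorem factor_proj (hE : IsHypertree E) (x : X) (k : Index Γ V J) (g₀ : Γ) :
    ∃ (A : Type) (f : Γ → A),
      (∀ y z, r.Factor k x g₀ y → r.Factor k x g₀ z → f y = f z → y = z) ∧
      ∀ l y z, r.Factor l x y z → ¬ (l = k ∧ r.Factor k x g₀ y) → f y = f z := by
  classical
  by_cases htriv : ∀ y, r.Factor k x g₀ y → y = g₀
  · exact ⟨Unit, fun _ => (), fun y z hy hz _ => (htriv y hy).trans (htriv z hz).symm,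
      fun _ _ _ _ _ => rfl⟩
  push Not at htriv
  obtain ⟨y₀, hy₀, hne⟩ := htriv
  have hC : ∀ l y z, r.Factor l x y z → (l = k ∧ r.Factor k x g₀ z) →
      (l = k ∧ r.Factor k x g₀ y) := by
    rintro l y z h ⟨rfl, h'⟩
    exact ⟨rfl, (r.factor_equivalence hE l x).trans h' ((r.factor_equivalence hE l x).symm h)⟩
  have hrep : ∀ (pr : V → V) (j : J) (v : V), (∀ w, E j v w → pr w = w) →
      (∀ k w w', E k w w' → ¬(k = j ∧ E j v w) → pr w = pr w') → ∀ a n y, r.RepDom a n x y →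
      r.p x (pr (T.b y⁻¹ (T.act y x) v₀)) =
        r.p x (pr (T.b (a * y)⁻¹ (T.act (a * y) x) v₀)) := by
    intro pr j v h1 h2 a n y hy
    rw [← hy.p_base]
    exact (r.p_proj x h1 h2 hE _).symm
  rcases k with ⟨j, u⟩ | ⟨j, u, a, n⟩ | ⟨a, n⟩
  · obtain ⟨w₀, -, -, hmin, htype, -, hp₀, -⟩ := hy₀.resolve_left (Ne.symm hne)
    obtain ⟨pr, pr1, pr2⟩ := hE.proj j w₀
    have hG := r.p_proj x pr1 pr2 hE
    set G : Γ → Γ := fun y => r.p x (pr (T.b y⁻¹ (T.act y x) v₀)) with hGdef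
    let f : Γ → Γ := fun y => if h : ∃ w, E j w₀ w ∧ r.p x w = y then
      (r.exists_shift hE j x h.choose).choose * y else y
    have hf : ∀ w a, E j w₀ w → r.Shift j x w a → f (r.p x w) = a * r.p x w := by
      intro w a hw ha
      have h : ∃ w', E j w₀ w' ∧ r.p x w' = r.p x w := ⟨w, hw, rfl⟩
      have hs := (r.exists_shift hE j x h.choose).choose_spec
      have hs' := (r.shift_congr hE ((hE.equiv j).trans ((hE.equiv j).symm hw) h.choose_spec.1)
        h.choose_spec.2.symm a).1 ha
      simp only [f, dif_pos h]
      rw [hs.unique hs']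
    have hf1 : ∀ w, E j w₀ w → r.IsMin j x w → f (r.p x w) = r.p x w := by
      intro w hw hm
      rw [hf w 1 hw (r.shift_one_iff.2 ⟨w, (hE.equiv j).refl w, hm, (one_mul _).symm⟩), one_mul]
    refine ⟨Γ, fun y => f (G y), ?_, r.collapse_of hC ?_ ?_ ?_⟩
    · have hfix : ∀ y, r.Factor (.inl (j, u)) x g₀ y → f (G y) = y := by
        have aux : ∀ w, E j w₀ w → r.IsMin j x w → f (G (r.p x w)) = r.p x w := by
          intro w hw hm
          rw [hGdef]
          simp only [hG, pr1 w hw]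
          exact hf1 w hw hm
        rintro y (rfl | ⟨w, w', h1, h2, h3, h4, h5, h6⟩)
        · rw [← hp₀]
          exact aux w₀ ((hE.equiv j).refl _) hmin
        · have hw : w = w₀ := r.eq_of_type_eq (h5.trans hp₀.symm) (h3.trans htype.symm)
          rw [hw] at h1
          rw [← h6]
          refine aux w' h1 fun w'' hw'' => ?_
          rw [h4, ← htype]
          exact hmin _ ((hE.equiv j).trans h1 hw'')
      intro y z hy hz e
      rw [← hfix y hy, ← hfix z hz]
      exact e
    · rintro j' u' y z ⟨w, w', h1, h2, h3, h4, rfl, rfl⟩ hn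
      simp only [hGdef, hG]
      by_cases hc : j' = j ∧ E j w₀ w
      · obtain ⟨rfl, hw⟩ := hc
        have hu : u' = u := by
          rw [← h3, ← htype]
          exact (hmin.type_eq hE h2 hw).symm
        subst hu
        exact absurd ⟨rfl, Or.inr ⟨w₀, w, hw, hmin, htype, h3, hp₀, rfl⟩⟩ hn
      · rw [pr2 j' w w' h1 hc]
    · intro j' u' a' n' y hy hn
      obtain ⟨w, w', h1, rfl, h3, h4, h5, h6, -⟩ := hy.exists_edge
      rw [← h3]
      simp only [hGdef, hG]
      by_cases hc : j' = j ∧ E j w₀ w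
      · obtain ⟨rfl, hw⟩ := hc
        have hw' := (hE.equiv j').trans hw h1
        rw [pr1 _ hw, pr1 _ hw', hf w a' hw h6, hf1 w' hw' h4, h3]
      · rw [pr2 j' w w' h1 hc]
    · intro a' n' y hy _
      simp only [hGdef]
      rw [hrep pr j w₀ pr1 pr2 a' n' y hy]
  · obtain ⟨s, hs, hgs, hclass⟩ := Arrow.exists_source (fun g h h' => by
      have := h'.2.1
      rw [T.act_mul] at this
      exact h.2.1.not_next this) hy₀ hne
    obtain ⟨w₀, w₁, e1, e2, e3, e4, e5, e6, e7⟩ := hs.exists_edge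
    obtain ⟨pr, pr1, pr2⟩ := hE.proj j w₀
    have hG := r.p_proj x pr1 pr2 hE
    set G : Γ → Γ := fun y => r.p x (pr (T.b y⁻¹ (T.act y x) v₀)) with hGdef
    have hGfix : ∀ w, E j w₀ w → G (r.p x w) = r.p x w := by
      intro w hw
      rw [hGdef]
      simp only [hG, pr1 w hw]
    have hnot : ∀ w, E j w₀ w → r.IsMin j x w → r.p x w ≠ s := by
      intro w hw hm hps
      refine hs.1 (e6.unique (r.shift_one_iff.2 ⟨w, hw, hm, ?_⟩))
      rw [hps, e2, one_mul]
    refine ⟨Prop, fun y => G y = s, ?_, r.collapse_of hC ?_ ?_ ?_⟩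
    · have g1 : G s = s := by
        have := hGfix w₀ ((hE.equiv j).refl _)
        rwa [e2] at this
      have g2 : G (a * s) ≠ s := by
        rw [← e3, hGfix w₁ e1]
        exact hnot w₁ e1 e4
      intro y z hy hz e
      rcases hclass y hy with rfl | rfl <;> rcases hclass z hz with rfl | rfl
      · rfl
      · exact absurd (e.mp g1) g2
      · exact absurd (e.mpr g1) g2
      · rfl
    · intro j' u' y z hyz hn
      obtain ⟨w, w', h1, h2, h3, h4, rfl, rfl⟩ := hyz
      by_cases hc : j' = j ∧ E j w₀ w
      · obtain ⟨rfl, hw⟩ := hc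
        have hw' := (hE.equiv j').trans hw h1
        have hm' : r.IsMin j' x w' := fun w'' hw'' => by
          rw [h4, ← h3]
          exact h2 _ ((hE.equiv j').trans h1 hw'')
        rw [hGfix w hw, hGfix w' hw']
        exact propext (iff_of_false (hnot w hw h2) (hnot w' hw' hm'))
      · simp only [hGdef, hG]
        rw [pr2 j' w w' h1 hc]
    · intro j' u' a' n' y hy hn
      obtain ⟨w, w', h1, h2, h3, h4, h5, h6, h7⟩ := hy.exists_edge
      by_cases hc : j' = j ∧ E j w₀ w
      · obtain ⟨rfl, hw⟩ := hc
        have hw' := (hE.equiv j').trans hw h1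
        rw [← h3, hGfix w' hw', ← h2, hGfix w hw]
        refine propext (iff_of_false (fun hps => ?_) (hnot w' hw' h4))
        have hys : y = s := h2.symm.trans hps
        subst hys
        have ha : a' = a := h6.unique ((r.shift_congr hE hw (e2.trans h2.symm) a).1 e6)
        subst ha
        have hu : u' = u := by
          rw [← h5, ← e5]
          exact Encodable.encode_injective (le_antisymm
            (h7 _ ((hE.equiv j').symm hw) e2) (e7 _ hw h2))
        subst hu
        have hnn : n' = n := hy.2.1.unique hs.2.1
        subst hnn
        exact hn ⟨rfl, hgs⟩
      · rw [← h3, ← h2]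
        simp only [hGdef, hG]
        rw [pr2 j' w w' h1 hc]
    · intro a' n' y hy _
      simp only [hGdef]
      rw [hrep pr j w₀ pr1 pr2 a' n' y hy]
  · obtain ⟨s, hs, hgs, hclass⟩ := Arrow.exists_source (fun g h h' => by
      have := h'.2.1
      rw [T.act_mul] at this
      exact h.2.1.not_next this) hy₀ hne
    have has : a * s ≠ s := fun h => hs.1 (mul_eq_right.1 h)
    have hnot : ∀ w, r.p x w ≠ s := by
      intro w hw
      have h1 := r.p_p x w
      rw [hw, hs.p_base] at h1
      exact has h1
    refine ⟨Prop, fun y => y = s, ?_, r.collapse_of hC ?_ ?_ ?_⟩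
    · intro y z hy hz e
      rcases hclass y hy with rfl | rfl <;> rcases hclass z hz with rfl | rfl
      · rfl
      · exact absurd (e.mp rfl) has
      · exact absurd (e.mpr rfl) has
      · rfl
    · rintro j' u' y z ⟨w, w', h1, h2, h3, h4, rfl, rfl⟩ hn
      exact propext (iff_of_false (hnot w) (hnot w'))
    · intro j' u' a' n' y hy hn
      obtain ⟨w, w', h1, h2, h3, -⟩ := hy.exists_edge
      rw [← h3, ← h2]
      exact propext (iff_of_false (hnot w) (hnot w'))
    · intro a' n' y hy hn
      rw [← hy.p_base]
      refine propext (iff_of_false ?_ (hnot _))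
      rintro rfl
      have ha : a' = a := hy.2.2.symm.trans hs.2.2
      subst ha
      have hnn : n' = n := hy.2.1.unique hs.2.1
      subst hnn
      exact hn ⟨rfl, hgs⟩

theorem exists_arrow_eq (hE : IsHypertree E) [StandardBorelSpace X] (j : J) (x : X) (w : V) :
    ∃ w', E j w w' ∧ r.IsMin j x w' ∧
      Relation.EqvGen (fun a b => ∃ k, r.Factor k x a b) (r.p x w) (r.p x w') := by
  have : Nonempty V := ⟨v₀⟩
  obtain ⟨h1, h2⟩ := pick_spec (key := fun w => Encodable.encode (r.type x w))
    (P := fun w' => E j w w' ∧ r.p x w' = r.p x w) ⟨w, (hE.equiv j).refl w, rfl⟩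
  set z := pick (fun w => Encodable.encode (r.type x w)) fun w' => E j w w' ∧ r.p x w' = r.p x w
  obtain ⟨a, ha⟩ := r.exists_shift hE j x z
  obtain ⟨w', hw, hm, hp⟩ := ha.1
  refine ⟨w', (hE.equiv j).trans h1.1 hw, hm, ?_⟩
  rw [hp, h1.2]
  by_cases ha1 : a = 1
  · rw [ha1, one_mul]
    exact Relation.EqvGen.refl _
  · obtain ⟨n, hn⟩ := exists_separatedAt (x := T.act (r.p x w) x)
      (y := T.act a (T.act (r.p x w) x)) fun h => ha1 (T.free _ _ h.symm)
    refine Relation.EqvGen.rel _ _ ⟨.inr (.inl (j, r.type x z, a, n)), Or.inr (Or.inl ⟨⟨ha1, hn,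
      z, h1.2, rfl, ha, fun w'' hw'' hp'' => h2 w'' ⟨?_, hp''⟩⟩, rfl⟩)⟩
    exact (hE.equiv j).trans h1.1 hw''

theorem factor_generate (hE : IsHypertree E) [StandardBorelSpace X] (x : X) (g g' : Γ) :
    Relation.EqvGen (fun a b => ∃ k, r.Factor k x a b) g g' := by
  set S := fun a b => ∃ k, r.Factor k x a b
  have hrep : ∀ g, Relation.EqvGen S g (r.p x (T.b g⁻¹ (T.act g x) v₀)) := by
    intro g
    rw [r.p_base]
    by_cases h1 : r.p (T.act g x) v₀ = 1
    · rw [h1, one_mul]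
      exact Relation.EqvGen.refl _
    · obtain ⟨n, hn⟩ := exists_separatedAt (x := T.act g x)
        (y := T.act (r.p (T.act g x) v₀) (T.act g x)) fun h => h1 (T.free _ _ h.symm)
      exact Relation.EqvGen.rel _ _ ⟨.inr (.inr (_, n)), Or.inr (Or.inl ⟨⟨h1, hn, rfl⟩, rfl⟩)⟩
  have hconn : ∀ w w', Relation.EqvGen S (r.p x w) (r.p x w') := by
    intro w w'
    have := hE.connected w w'
    induction this with
    | rel w w' h =>
      obtain ⟨j, hj⟩ := h
      obtain ⟨z, h1, h2, h3⟩ := r.exists_arrow_eq hE j x w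
      obtain ⟨z', k1, k2, k3⟩ := r.exists_arrow_eq hE j x w'
      have hz : E j z z' := (hE.equiv j).trans ((hE.equiv j).symm h1) ((hE.equiv j).trans hj k1)
      refine h3.trans _ _ _ (Relation.EqvGen.trans _ _ _ ?_ (k3.symm _ _))
      exact Relation.EqvGen.rel _ _ ⟨.inl (j, r.type x z), Or.inr ⟨z, z', hz, h2, rfl,
        (h2.type_eq hE k2 hz).symm, rfl, rfl⟩⟩
    | refl w => exact Relation.EqvGen.refl _
    | symm w w' _ ih => exact ih.symm _ _
    | trans a b c _ _ h1 h2 => exact h1.trans _ _ _ h2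
  exact (hrep g).trans _ _ _ ((hconn _ _).trans _ _ _ ((hrep g').symm _ _))

end TreeField.Retraction

/-! ### Relations on the orbits of a free action -/

/-- The relation on `X` read off from an equivariant field of equivalence relations on `Γ`. -/
def PMPAction.orbitCBER {Γ X : Type} [Group Γ] [Countable Γ] [MeasurableSpace X]
    [StandardBorelSpace X] {μ : Measure X} (α : PMPAction Γ X μ) (R : X → Γ → Γ → Prop)
    (hR : ∀ x, Equivalence (R x)) (hact : ∀ h x g g', R (α.act h x) g g' ↔ R x (g * h) (g' * h))
    (hmeas : ∀ g g', Measurable fun x => R x g g') : CBER X where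
  dom := Set.univ
  dom_meas := MeasurableSet.univ
  rel y z := ∃ g, α.act g y = z ∧ R y 1 g
  rel_meas := by
    apply measurableSet_setOfPred.2
    have h1 : ∀ g, Measurable fun p : X × X => α.act g p.1 = p.2 := fun g =>
      measurable_mem.2 (measurableSet_eq_fun ((α.measurable g).comp measurable_fst) measurable_snd)
    have h2 : ∀ g, Measurable fun p : X × X => R p.1 1 g :=
      fun g => (hmeas 1 g).comp measurable_fst
    fun_prop
  rel_dom _ := ⟨trivial, trivial⟩
  refl x _ := ⟨1, α.act_one x, (hR x).refl 1⟩
  symm := by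
    rintro x y ⟨g, rfl, h⟩
    refine ⟨g⁻¹, α.act_inv_act g x, (hact _ _ _ _).2 ?_⟩
    rw [one_mul, inv_mul_cancel]
    exact (hR x).symm h
  trans := by
    rintro x y z ⟨g, rfl, h⟩ ⟨g', rfl, h'⟩
    refine ⟨g' * g, α.act_mul _ _ _, (hR x).trans h ?_⟩
    rw [hact, one_mul] at h'
    exact h'
  countable_classes x := by
    refine (Set.countable_range fun g => α.act g x).mono ?_
    rintro y ⟨g, hg, -⟩
    exact ⟨g, hg⟩

namespace TreeField

variable {Γ : Type} [Group Γ] {V J : Type} {E : J → V → V → Prop}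
  {X : Type} [MeasurableSpace X] {μ : Measure X} (T : TreeField Γ E X μ)

/-- For a freely indecomposable group, the decomposition attached to a field of hypertrees is
trivialized by sets whose returns stabilize a hyperedge. -/
theorem exists_hyperedge_stabilizing [Countable Γ] [Infinite Γ] (hΓ : MFI Γ) [Countable V]
    [Countable J] [StandardBorelSpace X] [IsProbabilityMeasure μ] (hE : IsHypertree E) (v₀ : V) :
    ∃ U : J → V → Set X, (∀ j v, MeasurableSet (U j v)) ∧
      (∀ j v, ∀ x ∈ U j v, ∀ g, T.act g x ∈ U j v → E j (T.b g x v) v) ∧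
      ∀ᵐ x ∂μ, ∃ g j v, T.act g x ∈ U j v := by
  classical
  let _ := Encodable.ofCountable Γ
  let _ := Encodable.ofCountable V
  obtain ⟨p, h1, h2, h3⟩ := T.exists_retraction hE v₀
  let r : T.Retraction v₀ := ⟨p, h1, h2, h3⟩
  let R : CBER X := T.orbitCBER (fun _ _ _ => True)
    (fun _ => ⟨fun _ => trivial, fun _ => trivial, fun _ _ => trivial⟩)
    (fun _ _ _ _ => Iff.rfl) (fun _ _ => measurable_const)
  let Rf : Retraction.Index Γ V J → CBER X := fun k => T.orbitCBER (r.Factor k)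
    (r.factor_equivalence hE k) (r.factor_act k) (r.factor_meas k)
  have hRf : ∀ k x g g', (Rf k).rel (T.act g x) (T.act g' x) ↔ r.Factor k x g g' := by
    intro k x g g'
    constructor
    · rintro ⟨h, hh, hF⟩
      rw [← T.act_mul, T.act_eq_iff] at hh
      subst hh
      rwa [r.factor_act, one_mul] at hF
    · intro hF
      refine ⟨g' * g⁻¹, by rw [T.act_mul, T.act_inv_act], ?_⟩
      rwa [r.factor_act, one_mul, inv_mul_cancel_right]
  have hfree : FreelyIndep Rf := by
    intro n x i hn hx hne hrel
    have hg : ∀ j, ∃ g, j ≤ n → T.act g (x 0) = x j := by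
      intro j
      induction j with
      | zero => exact ⟨1, fun _ => T.act_one _⟩
      | succ j ih =>
        obtain ⟨g, hg⟩ := ih
        by_cases hj : j < n
        · obtain ⟨g', h, -⟩ := hrel j hj
          refine ⟨g' * g, fun _ => ?_⟩
          rw [T.act_mul, hg hj.le, h]
        · exact ⟨1, fun h => absurd h (by omega)⟩
    choose g hg using hg
    refine no_reduced_cycle (fun k => r.Factor k (x 0))
      (fun k => r.factor_equivalence hE k _) (r.factor_proj hE (x 0)) n g i hn ?_ ?_ ?_
    · rw [← T.act_eq_iff _ _ (x 0), hg n le_rfl, hg 0 (Nat.zero_le _), hx]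
    · intro j hj e
      refine hne j hj ?_
      rw [← hg j hj.le, ← hg (j + 1) hj, e]
    · intro j hj
      rw [← hRf, hg j hj.le, hg (j + 1) hj]
      exact hrel j hj
  have hprod : IsFreeProduct R Rf := by
    refine ⟨hfree, ?_, fun x y => ⟨?_, ?_⟩⟩
    · refine (Set.eq_univ_of_forall fun x => Set.mem_iUnion.2 ?_).symm
      obtain ⟨k, -⟩ : ∃ k : Retraction.Index Γ V J, True := ⟨.inr (.inr (1, 0, true)), trivial⟩
      exact ⟨k, trivial⟩
    · rintro ⟨g, rfl, -⟩
      refine ⟨trivial, ?_⟩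
      have key : ∀ a b, Relation.EqvGen (fun a b => ∃ k, r.Factor k x a b) a b →
          Relation.EqvGen (fun a b => ∃ i, (Rf i).rel a b) (T.act a x) (T.act b x) := by
        intro a b h
        induction h with
        | rel a b h =>
          obtain ⟨k, hk⟩ := h
          exact Relation.EqvGen.rel _ _ ⟨k, (hRf k x a b).2 hk⟩
        | refl a => exact Relation.EqvGen.refl _
        | symm a b _ ih => exact ih.symm _ _
        | trans a b c _ _ h1 h2 => exact h1.trans _ _ _ h2
      have := key 1 g (r.factor_generate hE x 1 g)
      rwa [T.act_one] at this
    · rintro ⟨-, h⟩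
      induction h with
      | rel a b h =>
        obtain ⟨k, g, hg, -⟩ := h
        exact ⟨g, hg, trivial⟩
      | refl a => exact R.refl a trivial
      | symm a b _ ih => exact R.symm ih
      | trans a b c _ _ h1 h2 => exact R.trans h1 h2
  have hindec : FreelyIndecomposableMod μ R := by
    refine hΓ X μ T.toPMPAction R (ae_of_all _ fun x g => T.free g x) ⟨rfl, fun x y => ?_⟩
    exact ⟨fun ⟨g, hg, _⟩ => ⟨g, Subgroup.mem_top g, hg⟩, fun ⟨g, _, hg⟩ => ⟨g, hg, trivial⟩⟩
  obtain ⟨U, C, hU, -, -, hC, hCnull, hcover, -, hrel⟩ := hindec _ inferInstance Rf hprod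
  have hret : ∀ k, ∀ x ∈ U k ∩ C, ∀ g, T.act g x ∈ U k ∩ C → r.Factor k x 1 g := by
    intro k x hx g hg
    have := (hrel k x hx _ hg).1 ⟨g, rfl, trivial⟩
    rw [← hRf, T.act_one]
    exact this
  have harrow : ∀ k x (D : X → Γ → Prop) (a g : Γ), r.Factor k x 1 g →
      (∀ g', r.Factor k x 1 g' → Retraction.Arrow (D x) a 1 g') → g ∈ ({1, a, a⁻¹} : Finset Γ) := by
    intro k x D a g hg hD
    rcases hD g hg with h | ⟨-, h⟩ | ⟨-, h⟩
    · simp [← h]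
    · simp [h]
    · simp [eq_inv_of_mul_eq_one_right h.symm]
  have hnull : ∀ k, μ (U (.inr k) ∩ C) = 0 := by
    rintro (⟨j, u, a, n⟩ | ⟨a, n⟩)
    · exact T.measure_eq_zero_of_finite_returns ((hU _).inter hC) {1, a, a⁻¹} fun x hx g hg =>
        harrow _ x (r.StarDom j u a n) a g (hret _ x hx g hg) fun g' h => h
    · exact T.measure_eq_zero_of_finite_returns ((hU _).inter hC) {1, a, a⁻¹} fun x hx g hg =>
        harrow _ x (r.RepDom a n) a g (hret _ x hx g hg) fun g' h => h
  refine ⟨fun j v => U (.inl (j, v)) ∩ C, fun j v => (hU _).inter hC, ?_, ?_⟩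
  · intro j v x hx g hg
    rcases hret _ x hx g hg with h | ⟨w, w', h1, -, h3, h4, h5, h6⟩
    · rw [← h, T.b_one]
      exact (hE.equiv j).refl v
    · have hw : w = v := by rw [← h3, Retraction.type, h5, T.b_one]
      have hw' : T.b g x w' = v := by rw [← h4, Retraction.type, h6]
      have := T.b_E j _ _ g x h1
      rwa [hw, hw'] at this
  · have hC' : ∀ᵐ x ∂μ, x ∈ C := hCnull
    have hN : ∀ᵐ x ∂μ, ∀ k, x ∉ U (.inr k) ∩ C :=
      ae_all_iff.2 fun k => measure_eq_zero_iff_ae_notMem.1 (hnull k)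
    filter_upwards [T.toPMPAction.ae_act hC', T.toPMPAction.ae_act hN] with x h1 h2
    have hx := h1 1
    rw [T.act_one] at hx
    obtain ⟨y, hy, g, rfl, -⟩ := hcover x ⟨trivial, hx⟩
    obtain ⟨k, hk⟩ := Set.mem_iUnion.1 hy
    rcases k with ⟨j, v⟩ | k
    · exact ⟨g, j, v, hk, h1 g⟩
    · exact absurd ⟨hk, h1 g⟩ (h2 g k)

/-- An infinite freely indecomposable group has no field of hypertrees with hyperedges of size
at most two. -/
theorem false_of_small_hyperedges (T : TreeField Γ E X μ) [Countable Γ] [Infinite Γ]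
    (hΓ : MFI Γ) [Countable V] [Countable J] [StandardBorelSpace X] [IsProbabilityMeasure μ]
    (hE : IsHypertree E) (v₀ : V)
    (hsmall : ∀ j v, ∃ v', ∀ w, E j v w → w = v ∨ w = v') : False := by
  obtain ⟨U, hU, hret, hcover⟩ := T.exists_hyperedge_stabilizing hΓ hE v₀
  choose o ho using hsmall
  have hnull : ∀ j v (s t : Γ), μ {x | x ∈ U j v ∧ T.sg x v = s ∧ T.sg x (o j v) = t} = 0 := by
    intro j v s t
    classical
    have hmeas : MeasurableSet {x | x ∈ U j v ∧ T.sg x v = s ∧ T.sg x (o j v) = t} := by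
      apply measurableSet_setOfPred.2
      have h1 := T.sg_meas
      have h2 := measurable_mem.2 (hU j v)
      fun_prop
    refine T.measure_eq_zero_of_finite_returns hmeas {1, t⁻¹ * s} fun x hx g hg => ?_
    have hb := hret j v x hx.1 g hg.1
    have hsg := T.sg_act g x v
    rcases ho j v _ ((hE.equiv j).symm hb) with h | h
    · rw [h, hg.2.1, hx.2.1] at hsg
      simp [mul_eq_left.1 hsg]
    · rw [h, hg.2.2, hx.2.1] at hsg
      simp [← hsg]
  have hN : ∀ᵐ x ∂μ, ∀ j v s t, ¬ (x ∈ U j v ∧ T.sg x v = s ∧ T.sg x (o j v) = t) := by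
    simp only [ae_all_iff]
    exact fun j v s t => measure_eq_zero_iff_ae_notMem.1 (hnull j v s t)
  have hfalse : ∀ᵐ _ ∂μ, False := by
    filter_upwards [hcover, T.toPMPAction.ae_act hN] with x ⟨g, j, v, h⟩ h2
    exact h2 g j v _ _ ⟨h, rfl, rfl⟩
  rw [ae_iff] at hfalse
  simp at hfalse

end TreeField

/-! ### Exact fundamental domains -/

namespace PMPAction

variable {H Ω : Type} [Group H] [MeasurableSpace Ω] {ν : Measure Ω}

theorem measurableSet_act_mem (β : PMPAction H Ω ν) {D : Set Ω} (hD : MeasurableSet D) (h : H) :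
    MeasurableSet {ω | β.act h ω ∈ D} :=
  β.measurable h hD

theorem measure_eq_tsum [Countable H] (β : PMPAction H Ω ν) {D : Set Ω}
    (hD : MeasurableSet D) (hu : ∀ ω, ∃! h, β.act h ω ∈ D) {A : Set Ω} (hA : MeasurableSet A) :
    ν A = ∑' h, ν (A ∩ {ω | β.act h ω ∈ D}) := by
  rw [← measure_iUnion]
  · congr 1
    ext ω
    obtain ⟨h, hh, -⟩ := hu ω
    simp only [Set.mem_iUnion, Set.mem_inter_iff, Set.mem_ofPred_eq]
    exact ⟨fun hω => ⟨h, hω, hh⟩, fun ⟨_, hω, _⟩ => hω⟩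
  · intro h h' hne
    refine Set.disjoint_left.2 fun ω h1 h2 => hne ?_
    exact (hu ω).unique h1.2 h2.2
  · exact fun h => hA.inter (β.measurableSet_act_mem hD h)

/-- A set meeting every orbit at most once is not larger than a fundamental domain. -/
theorem measure_le_of_injOn [Countable H] (β : PMPAction H Ω ν) {D : Set Ω}
    (hD : MeasurableSet D) (hu : ∀ ω, ∃! h, β.act h ω ∈ D) {A : Set Ω} (hA : MeasurableSet A)
    (hinj : ∀ ω h, ω ∈ A → β.act h ω ∈ A → h = 1) : ν A ≤ ν D := by
  have h1 : ∀ h, ν (A ∩ {ω | β.act h ω ∈ D}) = ν (D ∩ {ω | β.act h⁻¹ ω ∈ A}) := by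
    intro h
    rw [← β.measure_preimage h (hD.inter (β.measurableSet_act_mem hA h⁻¹))]
    congr 1
    ext ω
    simp only [Set.mem_inter_iff, Set.mem_preimage, Set.mem_ofPred_eq, β.act_inv_act]
    exact and_comm
  rw [β.measure_eq_tsum hD hu hA]
  simp only [h1]
  rw [← measure_iUnion]
  · exact measure_mono (Set.iUnion_subset fun h => Set.inter_subset_left)
  · intro h h' hne
    refine Set.disjoint_left.2 fun ω k1 k2 => hne ?_
    have k3 : β.act (h'⁻¹ * h) (β.act h⁻¹ ω) ∈ A := by
      rw [β.act_mul, β.act_act_inv]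
      exact k2.2
    exact (inv_mul_eq_one.1 (hinj _ _ k1.2 k3)).symm
  · exact fun h => hD.inter (β.measurableSet_act_mem hA h⁻¹)

end PMPAction

/-! ### Fields of hypertrees from couplings -/

/-- Commuting actions of `Γ` and `H` with fundamental domains, together with an `H`-equivariant
assignment of fundamental domains of `Γ` to the vertices of an `H`-invariant hypertree. -/
structure TreeCoupling (Γ H : Type) [Group Γ] [Group H] {V J : Type} [MulAction H V]
    (E : J → V → V → Prop) (Ω : Type) [MeasurableSpace Ω] (ν : Measure Ω) where
  a : PMPAction Γ Ω ν
  b : PMPAction H Ω ν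
  comm : ∀ g h ω, a.act g (b.act h ω) = b.act h (a.act g ω)
  free : ∀ g h ω, a.act g ω = b.act h ω → g = 1
  D : Set Ω
  D_meas : MeasurableSet D
  D_unique : ∀ ω, ∃! h, b.act h ω ∈ D
  D_pos : ν D ≠ 0
  D_fin : ν D ≠ ⊤
  E_smul : ∀ j v w (h : H), E j v w → E j (h • v) (h • w)
  F : V → Set Ω
  F_meas : ∀ v, MeasurableSet (F v)
  F_smul : ∀ (h : H) ω v, b.act h ω ∈ F (h • v) ↔ ω ∈ F v
  F_unique : ∀ ω v, ∃! g, a.act g ω ∈ F v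

namespace TreeCoupling

variable {Γ H : Type} [Group Γ] [Group H] {V J : Type} [MulAction H V]
  {E : J → V → V → Prop} {Ω : Type} [MeasurableSpace Ω] {ν : Measure Ω}
  (C : TreeCoupling Γ H E Ω ν)

/-- The cocycle of the induced action on the fundamental domain. -/
noncomputable def coc (g : Γ) (ω : Ω) : H := (C.D_unique (C.a.act g ω)).choose

theorem coc_eq_iff (g : Γ) (ω : Ω) (h : H) :
    C.coc g ω = h ↔ C.b.act h (C.a.act g ω) ∈ C.D :=
  ⟨fun e => e ▸ (C.D_unique (C.a.act g ω)).choose_spec.1,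
    fun e => ((C.D_unique (C.a.act g ω)).choose_spec.2 h e).symm⟩

theorem coc_mem (g : Γ) (ω : Ω) : C.b.act (C.coc g ω) (C.a.act g ω) ∈ C.D :=
  (C.coc_eq_iff g ω _).1 rfl

theorem coc_mul (g g' : Γ) (ω : Ω) :
    C.coc (g * g') ω = C.coc g (C.b.act (C.coc g' ω) (C.a.act g' ω)) * C.coc g' ω := by
  rw [coc_eq_iff, C.b.act_mul, C.a.act_mul, ← C.comm g (C.coc g' ω)]
  exact C.coc_mem g _

theorem coc_meas (g : Γ) (h : H) : Measurable fun ω => C.coc g ω = h := by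
  simp only [coc_eq_iff]
  exact measurable_mem.2 (C.a.measurable g (C.b.measurable h C.D_meas))

/-- The induced map on the fundamental domain. -/
noncomputable def ind (g : Γ) (x : C.D) : C.D := ⟨_, C.coc_mem g x⟩

/-- The normalized measure on the fundamental domain. -/
noncomputable def indMeasure : Measure C.D := (ν C.D)⁻¹ • ν.comap Subtype.val

theorem indMeasure_apply (A : Set C.D) :
    C.indMeasure A = (ν C.D)⁻¹ * ν (Subtype.val '' A) := by
  rw [indMeasure, Measure.smul_apply, comap_subtype_coe_apply C.D_meas, smul_eq_mul]

theorem isProbabilityMeasure_indMeasure : IsProbabilityMeasure C.indMeasure := by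
  constructor
  rw [C.indMeasure_apply, Set.image_univ, Subtype.range_val]
  exact ENNReal.inv_mul_cancel C.D_pos C.D_fin

theorem ind_eq_iff (g : Γ) (x : C.D) {A : Set Ω} (hA : A ⊆ C.D) :
    (C.ind g x : Ω) ∈ A ↔ ∃ h, C.b.act h (C.a.act g x) ∈ A := by
  refine ⟨fun h => ⟨_, h⟩, fun ⟨h, hh⟩ => ?_⟩
  have := (C.coc_eq_iff g x h).2 (hA hh)
  simp only [ind, this]
  exact hh

theorem ind_measurable [Countable H] (g : Γ) : Measurable (C.ind g) := by
  refine Measurable.subtype_mk ?_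
  intro A hA
  have e : (fun x : C.D => C.b.act (C.coc g x) (C.a.act g x)) ⁻¹' A =
      {x : C.D | ∃ h, C.coc g x = h ∧ C.b.act h (C.a.act g x) ∈ A} := by
    ext x
    simp
  rw [e]
  apply measurableSet_setOfPred.2
  have h1 : ∀ h, Measurable fun x : C.D => C.coc g x = h := fun h =>
    (C.coc_meas g h).comp measurable_subtype_coe
  have h2 : ∀ h, Measurable fun x : C.D => C.b.act h (C.a.act g x) ∈ A := fun h =>
    (measurable_mem.2 (C.a.measurable g (C.b.measurable h hA))).comp measurable_subtype_coe
  fun_prop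

theorem measure_ind_preimage [Countable H] (g : Γ) {A : Set Ω} (hA : MeasurableSet A)
    (hAD : A ⊆ C.D) : ν {ω | ω ∈ C.D ∧ ∃ h, C.b.act h (C.a.act g ω) ∈ A} = ν A := by
  have e1 : {ω | ω ∈ C.D ∧ ∃ h, C.b.act h (C.a.act g ω) ∈ A} =
      ⋃ h, C.D ∩ {ω | C.b.act h (C.a.act g ω) ∈ A} := by
    ext ω
    simp
  have e2 : ∀ h, ν (C.D ∩ {ω | C.b.act h (C.a.act g ω) ∈ A}) =
      ν (C.a.act g ⁻¹' A ∩ {ω | C.b.act h⁻¹ ω ∈ C.D}) := by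
    intro h
    rw [← C.b.measure_preimage h
      ((C.a.measurable g hA).inter (C.b.measurableSet_act_mem C.D_meas h⁻¹))]
    congr 1
    ext ω
    simp only [Set.mem_inter_iff, Set.mem_preimage, Set.mem_ofPred_eq, C.b.act_inv_act, C.comm]
    exact and_comm
  rw [e1, measure_iUnion]
  · simp only [e2]
    rw [← C.a.measure_preimage g hA, C.b.measure_eq_tsum C.D_meas C.D_unique (C.a.measurable g hA)]
    exact (Equiv.inv H).tsum_eq fun h => ν (C.a.act g ⁻¹' A ∩ {ω | C.b.act h ω ∈ C.D})
  · intro h h' hne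
    refine Set.disjoint_left.2 fun ω k1 k2 => hne ?_
    exact (C.D_unique (C.a.act g ω)).unique (hAD k1.2) (hAD k2.2)
  · exact fun h => C.D_meas.inter (C.a.measurable g (C.b.measurable h hA))

theorem measurePreserving_ind [Countable H] (g : Γ) :
    MeasurePreserving (C.ind g) C.indMeasure C.indMeasure := by
  refine ⟨C.ind_measurable g, Measure.ext fun A hA => ?_⟩
  rw [Measure.map_apply (C.ind_measurable g) hA, C.indMeasure_apply, C.indMeasure_apply]
  have hA' : MeasurableSet (Subtype.val '' A : Set Ω) := C.D_meas.subtype_image hA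
  have hAD : (Subtype.val '' A : Set Ω) ⊆ C.D := Subtype.coe_image_subset _ _
  rw [← C.measure_ind_preimage g hA' hAD]
  congr 2
  ext ω
  constructor
  · rintro ⟨x, hx, rfl⟩
    exact ⟨x.2, (C.ind_eq_iff g x hAD).1 ⟨_, hx, rfl⟩⟩
  · rintro ⟨h1, h2⟩
    obtain ⟨y, hy, e⟩ := (C.ind_eq_iff g ⟨ω, h1⟩ hAD).2 h2
    refine ⟨⟨ω, h1⟩, ?_, rfl⟩
    have : y = C.ind g ⟨ω, h1⟩ := Subtype.ext e
    rw [Set.mem_preimage, ← this]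
    exact hy

/-- The field of hypertrees over the fundamental domain. -/
noncomputable def treeField [Countable H] : TreeField Γ E C.D C.indMeasure where
  act := C.ind
  act_one x := by
    refine Subtype.ext ?_
    have : C.coc 1 (x : Ω) = 1 := by
      rw [coc_eq_iff, C.a.act_one, C.b.act_one]
      exact x.2
    simp only [ind, this, C.a.act_one, C.b.act_one]
  act_mul g g' x := by
    refine Subtype.ext ?_
    simp only [ind, C.coc_mul]
    rw [C.b.act_mul, C.a.act_mul, ← C.comm g (C.coc g' x)]
  measurePreserving := C.measurePreserving_ind
  free g x hx := by
    refine C.free g (C.coc g x)⁻¹ x ?_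
    have := congrArg Subtype.val hx
    simp only [ind] at this
    rw [← C.b.act_inv_act (C.coc g x) (C.a.act g x), this]
  b g x v := C.coc g x • v
  b_one x v := by
    have : C.coc 1 (x : Ω) = 1 := by
      rw [coc_eq_iff, C.a.act_one, C.b.act_one]
      exact x.2
    rw [this, one_smul]
  b_mul g g' x v := by
    rw [C.coc_mul, mul_smul]
    rfl
  b_meas g v w := measurable_subst (f := fun x : C.D => C.coc g x) (Q := fun h _ => h • v = w)
    (fun h => (C.coc_meas g h).comp measurable_subtype_coe) fun h => measurable_const
  b_E j v w g x h := C.E_smul j v w _ h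
  F v := Subtype.val ⁻¹' C.F v
  F_meas v := measurable_subtype_coe (C.F_meas v)
  F_unique x v := by
    simp only [ind, Set.mem_preimage, C.F_smul]
    exact C.F_unique x v

theorem exists_hyperedge_stabilizing [Countable Γ] [Infinite Γ] (hΓ : MFI Γ) [Countable H]
    [Countable V] [Countable J] [StandardBorelSpace Ω] (hE : IsHypertree E) (v₀ : V) :
    ∃ U : J → V → Set Ω, (∀ j v, MeasurableSet (U j v)) ∧ (∀ j v, U j v ⊆ C.D) ∧
      (∀ j v, ∀ x ∈ U j v, ∀ x' ∈ U j v, ∀ g h, C.a.act g x = C.b.act h x' → E j v (h • v)) ∧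
      ∀ᵐ ω ∂ν, ∃ g h j v, C.a.act g (C.b.act h ω) ∈ U j v := by
  have := C.isProbabilityMeasure_indMeasure
  have := C.D_meas.standardBorel
  obtain ⟨U, h1, h2, h3⟩ := C.treeField.exists_hyperedge_stabilizing hΓ hE v₀
  refine ⟨fun j v => Subtype.val '' U j v, fun j v => C.D_meas.subtype_image (h1 j v),
    fun j v => Subtype.coe_image_subset _ _, ?_, ?_⟩
  · rintro j v _ ⟨x, hx, rfl⟩ _ ⟨x', hx', rfl⟩ g h e
    have hc : C.coc g (x : Ω) = h⁻¹ := by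
      rw [coc_eq_iff, e, C.b.act_inv_act]
      exact x'.2
    have hi : C.ind g x = x' := by
      refine Subtype.ext ?_
      simp only [ind, hc, e, C.b.act_inv_act]
    have := C.E_smul j _ _ h (h2 j v x hx g (by rw [← hi] at hx'; exact hx'))
    have hb : C.treeField.b g x v = h⁻¹ • v := by rw [← hc]; rfl
    rwa [hb, smul_inv_smul] at this
  · have hbad : ν (Subtype.val '' {x : C.D | ¬ ∃ g j v, C.treeField.act g x ∈ U j v}) = 0 := by
      have := ae_iff.1 h3
      rw [C.indMeasure_apply] at this
      exact (mul_eq_zero.1 this).resolve_left (ENNReal.inv_ne_zero.2 C.D_fin)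
    filter_upwards [C.b.ae_act (measure_eq_zero_iff_ae_notMem.1 hbad)] with ω hω
    obtain ⟨h, hh, -⟩ := C.D_unique ω
    have := hω h
    simp only [Set.mem_image, not_exists, not_and] at this
    have hx : ∃ g j v, C.treeField.act g ⟨_, hh⟩ ∈ U j v := by
      by_contra hc
      refine this ⟨_, hh⟩ ?_ rfl
      simpa using hc
    obtain ⟨g, j, v, hx⟩ := hx
    refine ⟨g, C.coc g (C.b.act h ω) * h, j, v, ⟨_, hx, ?_⟩⟩
    rw [C.b.act_mul, C.comm]
    rfl

theorem false_of_small_hyperedges (C : TreeCoupling Γ H E Ω ν) [Countable Γ] [Infinite Γ]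
    (hΓ : MFI Γ) [Countable H] [Countable V] [Countable J] [StandardBorelSpace Ω]
    (hE : IsHypertree E) (v₀ : V) (hsmall : ∀ j v, ∃ v', ∀ w, E j v w → w = v ∨ w = v') :
    False := by
  have := C.isProbabilityMeasure_indMeasure
  have := C.D_meas.standardBorel
  exact C.treeField.false_of_small_hyperedges hΓ hE v₀ hsmall

end TreeCoupling

/-! ### Hypertrees of free products -/

namespace Monoid.CoprodI

variable {ι : Type} {M : ι → Type} [∀ i, Group (M i)] [DecidableEq ι] [∀ i, DecidableEq (M i)]

theorem Word.fstIdx_mul_of_ne {k : ι} (m : M k) (t : Word M) :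
    ∀ j, t.fstIdx ≠ some j → (t = Word.empty → k ≠ j) →
      ((t.prod * of m) • (Word.empty : Word M)).fstIdx ≠ some j := by
  have single : ∀ (i j : ι) (n : M i), i ≠ j →
      (of n • (Word.empty : Word M)).fstIdx ≠ some j := by
    intro i j n hij
    by_cases hn : n = 1
    · simp [hn, Word.fstIdx, Word.empty]
    · have h0 : (Word.empty : Word M).fstIdx ≠ some i := by simp [Word.fstIdx, Word.empty]
      rw [← Word.cons_eq_smul (h1 := h0) (h2 := hn), Word.fstIdx_cons]
      simpa using hij
  induction t using Word.consRecOn with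
  | empty =>
    intro j _ h
    rw [Word.prod_empty, one_mul]
    exact single k j m (h rfl)
  | cons i n t h1 h2 ih =>
    intro j hj _
    rw [Word.fstIdx_cons] at hj
    have hij : i ≠ j := fun e => hj (by rw [e])
    rw [Word.prod_cons, mul_assoc, mul_smul]
    by_cases hu : ((t.prod * of m) • (Word.empty : Word M)).fstIdx = some i
    · have : t = Word.empty ∧ k = i := by
        by_contra hc
        exact ih i h1 (fun ht hk => hc ⟨ht, hk⟩) hu
      obtain ⟨rfl, rfl⟩ := this
      rw [Word.prod_empty, one_mul, ← mul_smul, ← map_mul]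
      exact single k j (n * m) hij
    · rw [← Word.cons_eq_smul (h1 := hu) (h2 := h2), Word.fstIdx_cons]
      simpa using hij

theorem Word.equivPair_head_mul_of {k j : ι} (m : M k) (w : CoprodI M)
    (h : (∃ n : M j, w = of n) → k ≠ j) :
    (Word.equivPair j ((w * of m) • (Word.empty : Word M))).head =
      (Word.equivPair j (w • (Word.empty : Word M))).head := by
  set p := Word.equivPair j (w • (Word.empty : Word M)) with hp
  have hw : w = of p.head * p.tail.prod := by
    rw [← Word.prod_rcons, ← Word.equivPair_symm, hp, Equiv.symm_apply_apply, Word.prod_smul,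
      Word.prod_empty, mul_one]
  have hu := Word.fstIdx_mul_of_ne m p.tail j p.fstIdx_ne fun e => h ⟨p.head, by
    rw [e, Word.prod_empty, mul_one] at hw
    exact hw⟩
  have : w * of m = of p.head * (p.tail.prod * of m) := by rw [← mul_assoc, ← hw]
  rw [this, mul_smul, Word.equivPair_smul_same,
    Word.equivPair_eq_of_fstIdx_ne hu]
  simp

end Monoid.CoprodI

theorem IsHypertree.comap {V V' J : Type} {E : J → V → V → Prop} (hE : IsHypertree E)
    (e : V' ≃ V) : IsHypertree fun j v w => E j (e v) (e w) where
  equiv j := ⟨fun v => (hE.equiv j).refl _, (hE.equiv j).symm, (hE.equiv j).trans⟩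
  proj j v := by
    obtain ⟨pr, h1, h2⟩ := hE.proj j (e v)
    exact ⟨fun w => e.symm (pr (e w)), fun w hw => by dsimp only; rw [h1 _ hw, e.symm_apply_apply],
      fun k w w' h h' => by dsimp only; rw [h2 k _ _ h h']⟩
  connected v w := by
    have key : ∀ a b, Relation.EqvGen (fun a b => ∃ j, E j a b) a b →
        Relation.EqvGen (fun a b => ∃ j, E j (e a) (e b)) (e.symm a) (e.symm b) := by
      intro a b h
      induction h with
      | rel a b h => exact .rel _ _ (by simpa using h)
      | refl a => exact .refl _
      | symm a b _ ih => exact .symm _ _ ih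
      | trans a b c _ _ ih ih' => exact .trans _ _ _ ih ih'
    simpa using key _ _ (hE.connected (e v) (e w))

theorem isHypertree_coprodI {ι : Type} (M : ι → Type) [∀ i, Group (M i)] :
    IsHypertree fun (j : ι) (v w : Monoid.CoprodI M) =>
      v⁻¹ * w ∈ (Monoid.CoprodI.of : M j →* Monoid.CoprodI M).range where
  equiv j := ⟨fun v => by rw [inv_mul_cancel]; exact one_mem _,
    fun {v w} h => by
      have := inv_mem h
      rwa [mul_inv_rev, inv_inv] at this,
    fun {u v w} h h' => by
      have := mul_mem h h'
      rwa [mul_assoc, mul_inv_cancel_left] at this⟩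
  proj j v := by
    classical
    refine ⟨fun w => v * Monoid.CoprodI.of
      (Monoid.CoprodI.Word.equivPair j ((v⁻¹ * w) • Monoid.CoprodI.Word.empty)).head, ?_, ?_⟩
    · rintro w ⟨m, hm⟩
      dsimp only
      rw [← hm, Monoid.CoprodI.Word.equivPair_smul_same,
        Monoid.CoprodI.Word.equivPair_eq_of_fstIdx_ne
          (by simp [Monoid.CoprodI.Word.fstIdx, Monoid.CoprodI.Word.empty])]
      simp [hm]
    · rintro k w w' ⟨m, hm⟩ h
      dsimp only
      have : v⁻¹ * w' = v⁻¹ * w * Monoid.CoprodI.of m := by rw [hm]; group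
      rw [this, Monoid.CoprodI.Word.equivPair_head_mul_of]
      rintro ⟨n, hn⟩ hk
      exact h ⟨hk, n, hn.symm⟩
  connected v w := by
    have key : ∀ u v : Monoid.CoprodI M, Relation.EqvGen (fun a b => ∃ j,
        a⁻¹ * b ∈ (Monoid.CoprodI.of : M j →* Monoid.CoprodI M).range) v (v * u) := by
      intro u
      induction u using Monoid.CoprodI.induction_left with
      | one => intro v; rw [mul_one]; exact .refl _
      | mul m x ih =>
        intro v
        refine .trans _ (v * Monoid.CoprodI.of m) _ (.rel _ _ ⟨_, m, ?_⟩) ?_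
        · rw [inv_mul_cancel_left]
        · rw [← mul_assoc]
          exact ih _
    simpa using key (v⁻¹ * w) v

theorem IsFreeProductOf.isHypertree {G ι : Type} [Group G] {H : ι → Subgroup G}
    (h : IsFreeProductOf G H) : IsHypertree fun (j : ι) (v w : G) => v⁻¹ * w ∈ H j := by
  let e : Monoid.CoprodI (fun i => H i) ≃* G := MulEquiv.ofBijective _ h
  have he : ∀ j (m : H j), e (Monoid.CoprodI.of m) = m := fun j m => Monoid.CoprodI.lift_of (fun i => (H i).subtype) m
  convert (isHypertree_coprodI fun i => H i).comap e.symm.toEquiv using 4 with j v w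
  constructor
  · intro hm
    refine ⟨⟨_, hm⟩, e.injective ?_⟩
    rw [he]
    simp
  · rintro ⟨m, hm⟩
    have : (m : G) = v⁻¹ * w := by
      rw [← he, hm]
      simp
    exact this ▸ m.2

/-- The factors of a free product are malnormal. -/
theorem IsFreeProductOf.malnormal {G ι : Type} [Group G] {H : ι → Subgroup G}
    (h : IsFreeProductOf G H) {i i' : ι} {γ g : G} (hγ : γ ∈ H i) (hγ1 : γ ≠ 1)
    (hg : g⁻¹ * γ * g ∈ H i') : i' = i ∧ g ∈ H i := by
  obtain ⟨pr, h1, h2⟩ := h.isHypertree.proj i 1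
  simp only [inv_one, one_mul] at h1 h2
  have key : ∀ v w, Relation.EqvGen (fun a b => ∃ j, a⁻¹ * b ∈ H j) v w →
      (pr (γ * v) = γ * pr v ↔ pr (γ * w) = γ * pr w) := by
    intro v w hvw
    induction hvw with
    | rel v w hvw =>
      obtain ⟨k, hk⟩ := hvw
      by_cases hc : k = i ∧ v ∈ H i
      · obtain ⟨rfl, hv⟩ := hc
        have hw : w ∈ H k := by simpa using mul_mem hv hk
        rw [h1 v hv, h1 w hw, h1 _ (mul_mem hγ hv), h1 _ (mul_mem hγ hw)]
        simp
      · rw [h2 k v w hk hc, h2 k (γ * v) (γ * w) (by simpa [mul_assoc] using hk)]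
        rintro ⟨hk', hv⟩
        exact hc ⟨hk', (mul_mem_cancel_left hγ).1 hv⟩
    | refl v => rfl
    | symm v w _ ih => exact ih.symm
    | trans u v w _ _ ih ih' => exact ih.trans ih'
  have heq : pr (γ * g) = γ * pr g := by
    refine (key 1 g (h.isHypertree.connected 1 g)).1 ?_
    rw [h1 1 (one_mem _), mul_one, h1 γ hγ]
  by_contra hc
  have := h2 i' g (γ * g) (by rwa [← mul_assoc]) hc
  rw [heq] at this
  exact hγ1 (by simpa using this.symm)

/-! ### Constructions of actions -/

namespace PMPAction

variable {G H X Y : Type} [Group G] [Group H] [MeasurableSpace X] [MeasurableSpace Y]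
  {μ : Measure X} {η : Measure Y}

/-- Pulling back an action along a group homomorphism. -/
def comap (α : PMPAction G X μ) (f : H →* G) : PMPAction H X μ where
  act h := α.act (f h)
  act_one x := by rw [map_one, α.act_one]
  act_mul h h' x := by rw [map_mul, α.act_mul]
  measurePreserving h := α.measurePreserving (f h)

/-- The trivial action. -/
def trivial (G : Type) [Group G] (μ : Measure X) : PMPAction G X μ where
  act _ x := x
  act_one _ := rfl
  act_mul _ _ _ := rfl
  measurePreserving _ := MeasurePreserving.id μ

/-- The diagonal action on a product. -/
def prod [SFinite μ] [SFinite η] (α : PMPAction G X μ) (β : PMPAction G Y η) :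
    PMPAction G (X × Y) (μ.prod η) where
  act g p := (α.act g p.1, β.act g p.2)
  act_one p := by rw [α.act_one, β.act_one]
  act_mul g g' p := by rw [α.act_mul, β.act_mul]
  measurePreserving g := (α.measurePreserving g).prod (β.measurePreserving g)

/-- The action of a product of two groups defined by commuting actions. -/
def combine (α : PMPAction G X μ) (β : PMPAction H X μ)
    (comm : ∀ g h x, α.act g (β.act h x) = β.act h (α.act g x)) : PMPAction (G × H) X μ where
  act p x := α.act p.1 (β.act p.2 x)
  act_one x := by rw [Prod.fst_one, Prod.snd_one, α.act_one, β.act_one]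
  act_mul p q x := by
    rw [Prod.fst_mul, Prod.snd_mul, α.act_mul, β.act_mul, comm q.1 p.2]
  measurePreserving p := (α.measurePreserving p.1).comp (β.measurePreserving p.2)

theorem act_mem_iff (α : PMPAction G X μ) {S : Set X} (hS : ∀ g, ∀ x ∈ S, α.act g x ∈ S) (g : G)
    (x : X) : α.act g x ∈ S ↔ x ∈ S :=
  ⟨fun h => by simpa [α.act_inv_act] using hS g⁻¹ _ h, hS g x⟩

/-- The restriction of an action to an invariant set. -/
def restrict (α : PMPAction G X μ) (S : Set X) (hSm : MeasurableSet S)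
    (hS : ∀ g, ∀ x ∈ S, α.act g x ∈ S) : PMPAction G S (μ.comap Subtype.val) where
  act g x := ⟨α.act g x, hS g x x.2⟩
  act_one x := Subtype.ext (α.act_one x)
  act_mul g g' x := Subtype.ext (α.act_mul g g' x)
  measurePreserving g := by
    have hm : Measurable fun x : S => (⟨α.act g x, hS g x x.2⟩ : S) :=
      ((α.measurable g).comp measurable_subtype_coe).subtype_mk
    refine ⟨hm, Measure.ext fun A hA => ?_⟩
    rw [Measure.map_apply hm hA, comap_subtype_coe_apply hSm, comap_subtype_coe_apply hSm,
      ← α.measure_preimage g (hSm.subtype_image hA)]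
    congr 1
    ext x
    constructor
    · rintro ⟨y, hy, rfl⟩
      exact ⟨_, hy, rfl⟩
    · rintro ⟨y, hy, e⟩
      have hx : x ∈ S := (α.act_mem_iff hS g x).1 (by rw [← e]; exact y.2)
      refine ⟨⟨x, hx⟩, ?_, rfl⟩
      have : y = ⟨α.act g x, hS g x hx⟩ := Subtype.ext e
      rw [Set.mem_preimage, ← this]
      exact hy

theorem sigmaFinite_of_unique [Countable H] (β : PMPAction H X μ) {D : Set X}
    (hD : MeasurableSet D) (hu : ∀ x, ∃! h, β.act h x ∈ D) (hfin : μ D ≠ ⊤) : SigmaFinite μ := by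
  refine Measure.sigmaFinite_of_countable (Set.countable_range fun h => β.act h ⁻¹' D) ?_ ?_
  · rintro _ ⟨h, rfl⟩
    rw [β.measure_preimage h hD]
    exact hfin.lt_top
  · refine Set.eq_univ_of_forall fun x => ?_
    obtain ⟨h, hh, -⟩ := hu x
    exact ⟨_, ⟨h, rfl⟩, hh⟩

theorem isFundamentalDomainFor (α : PMPAction G X μ) {D : Set X} (hD : MeasurableSet D)
    (hu : ∀ x, ∃! g, α.act g x ∈ D) : IsFundamentalDomainFor μ α.act D := by
  refine ⟨hD, .of_forall fun x => (hu x).exists, fun g hg => ?_⟩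
  have : D ∩ α.act g ⁻¹' D = ∅ := by
    refine Set.eq_empty_of_forall_notMem fun x hx => hg ((hu x).unique hx.2 ?_)
    rw [α.act_one]
    exact hx.1
  rw [this, measure_empty]

/-- The Bernoulli action. -/
noncomputable def bernoulli (G : Type) [Group G] :
    PMPAction G (G → unitInterval) (Measure.infinitePi fun _ => volume) where
  act g z k := z (g⁻¹ * k)
  act_one z := by simp
  act_mul g h z := by simp [mul_assoc]
  measurePreserving g := ⟨by fun_prop,
    Measure.map_infinitePi_infinitePi_of_inj (mul_right_injective g⁻¹)⟩

theorem bernoulli_isFree (G : Type) [Group G] [Countable G] : (bernoulli G).IsFree := by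
  refine ae_all_iff.2 fun g => ?_
  by_cases hg : g = 1
  · simp [hg]
  have h1 : ∀ᵐ p : unitInterval × unitInterval ∂(volume.prod volume), p.1 ≠ p.2 := by
    rw [ae_iff]
    simp only [not_not]
    rw [Measure.measure_prod_null (measurableSet_eq_fun measurable_fst measurable_snd)]
    refine Filter.Eventually.of_forall fun x => ?_
    have : (Prod.mk x ⁻¹' {p : unitInterval × unitInterval | p.1 = p.2}) = {x} := by
      ext y
      simp [eq_comm]
    change volume (Prod.mk x ⁻¹' {p : unitInterval × unitInterval | p.1 = p.2}) = 0
    rw [this, measure_singleton]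
  have hne : (1 : G) ≠ g⁻¹ := fun e => hg (inv_eq_one.1 e.symm)
  rw [← Measure.infinitePi_map_eval_prod (P := fun _ : G => (volume : Measure unitInterval)) hne]
    at h1
  filter_upwards [ae_of_ae_map (by fun_prop) h1] with z hz e
  refine absurd ?_ hz
  have := congrFun e 1
  simp only [bernoulli, mul_one] at this
  exact this.symm

end PMPAction

/-! ### Exact couplings -/

/-- A coupling in which the fundamental domains and the freeness are exact, and in which
the two actions are jointly free. -/
structure ExactCoupling (G H : Type) [Group G] [Group H] (Ω : Type) [MeasurableSpace Ω]
    (ν : Measure Ω) where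
  a : PMPAction G Ω ν
  b : PMPAction H Ω ν
  comm : ∀ g h ω, a.act g (b.act h ω) = b.act h (a.act g ω)
  free : ∀ g h ω, a.act g ω = b.act h ω → g = 1 ∧ h = 1
  DG : Set Ω
  DG_meas : MeasurableSet DG
  DG_unique : ∀ ω, ∃! g, a.act g ω ∈ DG
  DG_pos : ν DG ≠ 0
  DG_fin : ν DG ≠ ⊤
  DH : Set Ω
  DH_meas : MeasurableSet DH
  DH_unique : ∀ ω, ∃! h, b.act h ω ∈ DH
  DH_pos : ν DH ≠ 0
  DH_fin : ν DH ≠ ⊤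

namespace ExactCoupling

variable {G H Ω : Type} [Group G] [Group H] [MeasurableSpace Ω] {ν : Measure Ω}

/-- Exchanging the two groups. -/
def symm (C : ExactCoupling G H Ω ν) : ExactCoupling H G Ω ν where
  a := C.b
  b := C.a
  comm h g ω := (C.comm g h ω).symm
  free h g ω e := (C.free g h ω e.symm).symm
  DG := C.DH
  DG_meas := C.DH_meas
  DG_unique := C.DH_unique
  DG_pos := C.DH_pos
  DG_fin := C.DH_fin
  DH := C.DG
  DH_meas := C.DG_meas
  DH_unique := C.DG_unique
  DH_pos := C.DG_pos
  DH_fin := C.DG_fin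

end ExactCoupling

theorem IsFundamentalDomainFor.ae_existsUnique {G X : Type} [Group G] [Countable G]
    [MeasurableSpace X] {μ : Measure X} (α : PMPAction G X μ) {D : Set X}
    (hD : IsFundamentalDomainFor μ α.act D) : ∀ᵐ x ∂μ, ∃! g, α.act g x ∈ D := by
  have h1 : ∀ᵐ x ∂μ, ∀ g, g ≠ 1 → ¬(x ∈ D ∧ α.act g x ∈ D) := by
    refine ae_all_iff.2 fun g => ?_
    by_cases hg : g = 1
    · simp [hg]
    · filter_upwards [measure_eq_zero_iff_ae_notMem.1 (hD.2.2 g hg)] with x hx _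
      exact hx
  filter_upwards [hD.2.1, α.ae_act h1] with x ⟨g, hg⟩ h2
  refine ⟨g, hg, fun g' hg' => ?_⟩
  by_contra hne
  refine h2 g (g' * g⁻¹) (fun e => hne (mul_inv_eq_one.1 e)) ⟨hg, ?_⟩
  rw [← α.act_mul, inv_mul_cancel_right]
  exact hg'

theorem MeasureEquivalent.exists_exactCoupling {G H : Type} [Group G] [Group H] [Countable G]
    [Countable H] (h : MeasureEquivalent G H) :
    ∃ (Ω : Type) (_ : MeasurableSpace Ω) (_ : StandardBorelSpace Ω) (ν : Measure Ω),
      Nonempty (ExactCoupling G H Ω ν) := by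
  obtain ⟨c⟩ := h
  let := c.mΩ
  have := c.sbΩ
  have := c.sigmaFinite
  let a₀ : PMPAction G c.Ω c.ν := ⟨c.aG, c.aG_one, c.aG_mul, c.mp_aG⟩
  let b₀ : PMPAction H c.Ω c.ν := ⟨c.aH, c.aH_one, c.aH_mul, c.mp_aH⟩
  let ζ : Measure (G → unitInterval) := Measure.infinitePi fun _ => volume
  let ν := c.ν.prod ζ
  let a : PMPAction G _ ν := a₀.prod (PMPAction.bernoulli G)
  let b : PMPAction H _ ν := b₀.prod (PMPAction.trivial H ζ)
  have comm : ∀ g h p, a.act g (b.act h p) = b.act h (a.act g p) := fun g h p =>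
    Prod.ext (c.comm g h p.1) rfl
  have hG : ∀ᵐ p ∂ν, ∃! g, a.act g p ∈ Prod.fst ⁻¹' c.DG :=
    Measure.quasiMeasurePreserving_fst.ae (c.fund_DG.ae_existsUnique a₀)
  have hH : ∀ᵐ p ∂ν, ∃! h, b.act h p ∈ Prod.fst ⁻¹' c.DH :=
    Measure.quasiMeasurePreserving_fst.ae (c.fund_DH.ae_existsUnique b₀)
  have hF : ∀ᵐ p ∂ν, ∀ g, (PMPAction.bernoulli G).act g p.2 = p.2 → g = 1 :=
    Measure.quasiMeasurePreserving_snd.ae (PMPAction.bernoulli_isFree G)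
  set S := {p : c.Ω × (G → unitInterval) | ∀ g h,
    (∃! g', a.act g' (a.act g (b.act h p)) ∈ Prod.fst ⁻¹' c.DG) ∧
    (∃! h', b.act h' (a.act g (b.act h p)) ∈ Prod.fst ⁻¹' c.DH) ∧
    ∀ g', (PMPAction.bernoulli G).act g' (a.act g (b.act h p)).2 =
      (a.act g (b.act h p)).2 → g' = 1}
  have hSm : MeasurableSet S := by
    have m0 : ∀ g h, Measurable fun p => a.act g (b.act h p) := fun g h =>
      (a.measurable g).comp (b.measurable h)
    have m1 : ∀ g h g', Measurable fun p => a.act g' (a.act g (b.act h p)) ∈ Prod.fst ⁻¹' c.DG :=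
      fun g h g' => measurable_mem.2 (((a.measurable g').comp (m0 g h))
        (measurable_fst c.fund_DG.1))
    have m2 : ∀ g h h', Measurable fun p => b.act h' (a.act g (b.act h p)) ∈ Prod.fst ⁻¹' c.DH :=
      fun g h h' => measurable_mem.2 (((b.measurable h').comp (m0 g h))
        (measurable_fst c.fund_DH.1))
    have m3 : ∀ g h g', Measurable fun p => (PMPAction.bernoulli G).act g'
        (a.act g (b.act h p)).2 = (a.act g (b.act h p)).2 := fun g h g' =>
      measurableSet_setOfPred.1 (measurableSet_eq_fun
        (((PMPAction.bernoulli G).measurable g').comp (measurable_snd.comp (m0 g h)))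
        (measurable_snd.comp (m0 g h)))
    apply measurableSet_setOfPred.2
    simp only [ExistsUnique]
    fun_prop
  have hSc : ν Sᶜ = 0 := by
    have : ∀ᵐ p ∂ν, p ∈ S := by
      filter_upwards [(a.combine b comm).ae_act hG, (a.combine b comm).ae_act hH,
        (a.combine b comm).ae_act hF] with p h1 h2 h3 g h
      exact ⟨h1 (g, h), h2 (g, h), h3 (g, h)⟩
    exact this
  have hSa : ∀ g, ∀ p ∈ S, a.act g p ∈ S := by
    intro g p hp g' h'
    rw [← comm, ← a.act_mul]
    exact hp _ _
  have hSb : ∀ h, ∀ p ∈ S, b.act h p ∈ S := by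
    intro h p hp g' h'
    rw [← b.act_mul]
    exact hp _ _
  have hS1 := fun p (hp : p ∈ S) => hp 1 1
  simp only [a.act_one, b.act_one] at hS1
  have hmeas : ∀ D : Set c.Ω, (ν.comap (Subtype.val : S → _)) {p : S | p.1.1 ∈ D} = c.ν D := by
    intro D
    have e : Subtype.val '' {p : S | p.1.1 ∈ D} = (D ×ˢ Set.univ) ∩ S := by
      ext p
      exact ⟨fun ⟨q, hq, e⟩ => e ▸ ⟨⟨hq, trivial⟩, q.2⟩, fun h => ⟨⟨p, h.2⟩, h.1.1, rfl⟩⟩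
    rw [comap_subtype_coe_apply hSm, e, measure_inter_conull hSc, Measure.prod_prod,
      measure_univ, mul_one]
  have hfree : ∀ g h p, (a.restrict S hSm hSa).act g p = (b.restrict S hSm hSb).act h p →
      g = 1 ∧ h = 1 := by
    intro g h p e
    have e' : a.act g p = b.act h p := congrArg Subtype.val e
    have hg : g = 1 := (hS1 p p.2).2.2 g (congrArg Prod.snd e')
    refine ⟨hg, ?_⟩
    rw [hg, a.act_one] at e'
    obtain ⟨h', hh', hu⟩ := (hS1 p p.2).2.1
    have := hu (h' * h) (by dsimp only; rw [b.act_mul, ← e']; exact hh')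
    simpa using this
  have := hSm.standardBorel
  exact ⟨S, inferInstance, inferInstance, ν.comap Subtype.val, ⟨{
    a := a.restrict S hSm hSa
    b := b.restrict S hSm hSb
    comm := fun g h p => Subtype.ext (comm g h p)
    free := hfree
    DG := {p : S | p.1.1 ∈ c.DG}
    DG_meas := measurable_fst.comp measurable_subtype_coe c.fund_DG.1
    DG_unique := fun p => (hS1 p p.2).1
    DG_pos := by rw [hmeas]; exact c.DG_pos.ne'
    DG_fin := by rw [hmeas]; exact c.DG_fin.ne
    DH := {p : S | p.1.1 ∈ c.DH}
    DH_meas := measurable_fst.comp measurable_subtype_coe c.fund_DH.1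
    DH_unique := fun p => (hS1 p p.2).2.1
    DH_pos := by rw [hmeas]; exact c.DH_pos.ne'
    DH_fin := by rw [hmeas]; exact c.DH_fin.ne }⟩⟩

/-! ### Subgroups of coupled groups -/

namespace PMPAction

variable {G H Ω : Type} [Group G] [Group H] [MeasurableSpace Ω] {ν : Measure Ω}

/-- A fundamental domain of a group gives one of each of its subgroups. -/
theorem exists_subgroup_domain [Countable G] (α : PMPAction G Ω ν) {D : Set Ω}
    (hD : MeasurableSet D) (hu : ∀ ω, ∃! g, α.act g ω ∈ D) (Γ : Subgroup G) :
    ∃ F, MeasurableSet F ∧ ∀ ω, ∃! γ : Γ, α.act γ ω ∈ F := by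
  refine ⟨{ω | ∃ g, α.act g ω ∈ D ∧ ((g : G ⧸ Γ).out : G) = g}, ?_, fun ω => ?_⟩
  · have : ∀ g, Measurable fun ω => α.act g ω ∈ D := fun g =>
      measurable_mem.2 (α.measurable g hD)
    apply measurableSet_setOfPred.2
    fun_prop
  · obtain ⟨g, hg, hg'⟩ := hu ω
    have key : ∀ γ : Γ, α.act γ ω ∈ {ω | ∃ g, α.act g ω ∈ D ∧ ((g : G ⧸ Γ).out : G) = g} ↔
        ((g : G ⧸ Γ).out : G) = g * (γ : G)⁻¹ := by
      intro γ
      have hq : ((g * (γ : G)⁻¹ : G) : G ⧸ Γ) = g := by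
        rw [QuotientGroup.eq]
        simp
      constructor
      · rintro ⟨k, hk, hk'⟩
        rw [← α.act_mul] at hk
        have : k = g * (γ : G)⁻¹ := eq_mul_inv_of_mul_eq (hg' _ hk)
        rwa [this, hq] at hk'
      · intro h
        refine ⟨g * (γ : G)⁻¹, ?_, by rw [hq, h]⟩
        rw [← α.act_mul, inv_mul_cancel_right]
        exact hg
    have hmem : ((g : G ⧸ Γ).out : G)⁻¹ * g ∈ Γ :=
      QuotientGroup.eq.1 (QuotientGroup.out_eq' _)
    refine ⟨⟨_, hmem⟩, (key _).2 (by simp), fun γ hγ => Subtype.ext ?_⟩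
    rw [eq_inv_mul_iff_mul_eq, (key γ).1 hγ, inv_mul_cancel_right]

/-- The saturation of a set under two commuting actions. -/
def saturation (a : PMPAction G Ω ν) (b : PMPAction H Ω ν) (A : Set Ω) : Set Ω :=
  {ω | ∃ g h, a.act g (b.act h ω) ∈ A}

theorem subset_saturation (a : PMPAction G Ω ν) (b : PMPAction H Ω ν) (A : Set Ω) :
    A ⊆ a.saturation b A := fun ω hω => ⟨1, 1, by rwa [a.act_one, b.act_one]⟩

theorem saturation_comm (a : PMPAction G Ω ν) (b : PMPAction H Ω ν) (A : Set Ω)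
    (comm : ∀ g h ω, a.act g (b.act h ω) = b.act h (a.act g ω)) :
    a.saturation b A = b.saturation a A := by
  ext ω
  simp only [saturation, comm, Set.mem_ofPred_eq]
  exact exists_comm

theorem measurableSet_saturation [Countable G] [Countable H] (a : PMPAction G Ω ν)
    (b : PMPAction H Ω ν) {A : Set Ω} (hA : MeasurableSet A) :
    MeasurableSet (a.saturation b A) := by
  have := fun g h => measurable_mem.2 (b.measurable h (a.measurable g hA))
  simp only [Set.mem_preimage] at this
  apply measurableSet_setOfPred.2
  fun_prop

theorem act_right_mem_saturation (a : PMPAction G Ω ν) (b : PMPAction H Ω ν) (A : Set Ω) (h : H)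
    (ω : Ω) (hω : ω ∈ a.saturation b A) : b.act h ω ∈ a.saturation b A := by
  obtain ⟨g, h', hm⟩ := hω
  refine ⟨g, h' * h⁻¹, ?_⟩
  rwa [← b.act_mul, inv_mul_cancel_right]

theorem act_left_mem_saturation (a : PMPAction G Ω ν) (b : PMPAction H Ω ν) (A : Set Ω)
    (comm : ∀ g h ω, a.act g (b.act h ω) = b.act h (a.act g ω)) (g : G)
    (ω : Ω) (hω : ω ∈ a.saturation b A) : a.act g ω ∈ a.saturation b A := by
  rw [a.saturation_comm b A comm] at hω ⊢
  exact b.act_right_mem_saturation a A g ω hω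

/-- If `A` meets the orbits of `H` at most once, and if the elements of `H` which map a point of
the `Γ`-saturation of `A` into it belong to `L`, then the saturation of `A` under `Γ` and `L`
admits a fundamental domain for `L`, of finite measure. -/
theorem exists_saturation_domain {Γ : Type} [Group Γ] [Countable Γ] [Countable H]
    (a : PMPAction Γ Ω ν) (b : PMPAction H Ω ν)
    (comm : ∀ g h ω, a.act g (b.act h ω) = b.act h (a.act g ω)) {D : Set Ω}
    (hD : MeasurableSet D) (hu : ∀ ω, ∃! h, b.act h ω ∈ D) (hfin : ν D ≠ ⊤) {A : Set Ω}
    (hA : MeasurableSet A) (hpos : ν A ≠ 0) (hinj : ∀ ω h, ω ∈ A → b.act h ω ∈ A → h = 1)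
    (L : Subgroup H) (hL : ∀ x ∈ A, ∀ x' ∈ A, ∀ g h, a.act g x = b.act h x' → h ∈ L) :
    ∃ D', MeasurableSet D' ∧ D' ⊆ a.saturation (b.comap L.subtype) A ∧
      (∀ ω ∈ a.saturation (b.comap L.subtype) A, ∃! l : L, b.act l ω ∈ D') ∧
      ν D' ≠ 0 ∧ ν D' ≠ ⊤ := by
  obtain ⟨key, hkey⟩ := exists_injective_nat Γ
  set D' := {ω | ∃ g, a.act g ω ∈ A ∧ ∀ g', key g' < key g → ∀ l : L, a.act g' (b.act l ω) ∉ A}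
    with hD'
  have hm : MeasurableSet D' := by
    have h1 := fun g => measurable_mem.2 (a.measurable g hA)
    have h2 := fun g (l : L) => measurable_mem.2 (b.measurable l (a.measurable g hA))
    simp only [Set.mem_preimage] at h1 h2
    apply measurableSet_setOfPred.2
    fun_prop
  have hD'inj : ∀ ω h, ω ∈ D' → b.act h ω ∈ D' → h = 1 := by
    rintro ω h ⟨g, hg, hmin⟩ ⟨g', hg', hmin'⟩
    have hl : h⁻¹ ∈ L := by
      refine hL _ hg _ hg' (g' * g⁻¹) h⁻¹ ?_
      rw [a.act_mul, a.act_inv_act, comm, b.act_inv_act]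
    have h1 : ¬ key g' < key g := fun hlt =>
      hmin g' hlt ⟨h, by simpa using inv_mem hl⟩ hg'
    have h2 : ¬ key g < key g' := fun hlt => by
      refine hmin' g hlt ⟨h⁻¹, hl⟩ ?_
      dsimp only
      rwa [b.act_inv_act]
    have : g = g' := hkey (by omega)
    subst this
    rw [comm] at hg'
    exact hinj _ _ hg hg'
  have hex : ∀ ω ∈ a.saturation (b.comap L.subtype) A, ∃ l : L, b.act l ω ∈ D' := by
    intro ω hω
    have hne : ∃ n, ∃ g, key g = n ∧ ∃ l : L, a.act g (b.act l ω) ∈ A := by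
      obtain ⟨g, l, hm⟩ := hω
      exact ⟨_, g, rfl, l, hm⟩
    classical
    obtain ⟨g, hg, l, hl⟩ := Nat.find_spec hne
    refine ⟨l, g, hl, fun g' hlt l' hmem => ?_⟩
    rw [hg] at hlt
    refine Nat.find_min hne hlt ⟨g', rfl, l' * l, ?_⟩
    rw [Subgroup.coe_mul, b.act_mul]
    exact hmem
  refine ⟨D', hm, ?_, fun ω hω => ?_, ?_, ?_⟩
  · rintro ω ⟨g, hg, -⟩
    exact ⟨g, 1, by rwa [(b.comap L.subtype).act_one]⟩
  · obtain ⟨l, hl⟩ := hex ω hω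
    refine ⟨l, hl, fun l' hl' => Subtype.ext ?_⟩
    have := hD'inj _ ((l' : H) * (l : H)⁻¹) hl (by
      rw [← b.act_mul, inv_mul_cancel_right]
      exact hl')
    exact mul_inv_eq_one.1 this
  · intro h0
    refine hpos (measure_mono_null (t := ⋃ l : L, b.act l ⁻¹' D') (fun ω hω => ?_) ?_)
    · exact Set.mem_iUnion.2 (hex ω (a.subset_saturation _ A hω))
    · refine measure_iUnion_null fun l => ?_
      rw [b.measure_preimage _ hm, h0]
  · exact ((b.measure_le_of_injOn hD hu hm hD'inj).trans_lt hfin.lt_top).ne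

/-- Recurrence of a set of positive measure modulo the action of `H`. -/
theorem exists_return {Γ : Type} [Group Γ] [Infinite Γ] [Countable Γ] [Countable H]
    (a : PMPAction Γ Ω ν) (b : PMPAction H Ω ν)
    (comm : ∀ g h ω, a.act g (b.act h ω) = b.act h (a.act g ω)) {D : Set Ω}
    (hD : MeasurableSet D) (hu : ∀ ω, ∃! h, b.act h ω ∈ D) (hfin : ν D ≠ ⊤) {A : Set Ω}
    (hA : MeasurableSet A) (hpos : ν A ≠ 0) (hinj : ∀ ω h, ω ∈ A → b.act h ω ∈ A → h = 1) :
    ∃ γ : Γ, γ ≠ 1 ∧ ∃ x ∈ A, ∃ x' ∈ A, ∃ h, a.act γ x = b.act h x' := by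
  by_contra hc
  push Not at hc
  have hret : ∀ ω γ γ' h, a.act γ ω ∈ A → a.act γ' (b.act h ω) ∈ A → γ = γ' := by
    intro ω γ γ' h h1 h2
    by_contra hne
    refine hc (γ' * γ⁻¹) (fun e => hne (mul_inv_eq_one.1 e).symm) _ h1 _ h2 h⁻¹ ?_
    rw [a.act_mul, a.act_inv_act, comm, b.act_inv_act]
  have hle : ν (⋃ γ, a.act γ ⁻¹' A) ≤ ν D := by
    refine b.measure_le_of_injOn hD hu (.iUnion fun γ => a.measurable γ hA) ?_
    intro ω h h1 h2
    obtain ⟨γ, h1⟩ := Set.mem_iUnion.1 h1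
    obtain ⟨γ', h2⟩ := Set.mem_iUnion.1 h2
    obtain rfl := hret ω γ γ' h h1 h2
    rw [Set.mem_preimage, comm] at h2
    exact hinj _ _ h1 h2
  rw [measure_iUnion] at hle
  · simp only [a.measure_preimage _ hA, ENNReal.tsum_const_eq_top_of_ne_zero hpos] at hle
    exact hfin (top_le_iff.1 hle)
  · intro γ γ' hne
    refine Set.disjoint_left.2 fun ω h1 h2 => hne (hret ω γ γ' 1 h1 ?_)
    rwa [b.act_one]
  · exact fun γ => a.measurable γ hA

end PMPAction

namespace ExactCoupling

variable {G H Ω : Type} [Group G] [Group H] [MeasurableSpace Ω] {ν : Measure Ω}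

theorem exists_stabilizing_sets [Countable G] [Countable H] [StandardBorelSpace Ω]
    (C : ExactCoupling G H Ω ν) (Γ : Subgroup G) [Infinite Γ] (hΓ : MFI Γ) {K : Type}
    [Countable K] {L : K → Subgroup H} (hL : IsFreeProductOf H L) :
    ∃ A : K → H → Set Ω, (∀ j v, MeasurableSet (A j v)) ∧
      (∀ j v ω h, ω ∈ A j v → C.b.act h ω ∈ A j v → h = 1) ∧
      (∀ j v, ∀ x ∈ A j v, ∀ x' ∈ A j v, ∀ (g : Γ) h, C.a.act g x = C.b.act h x' → h ∈ L j) ∧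
      ∀ᵐ ω ∂ν, ∃ (g : Γ) (h : H) (j : K) (v : H), C.a.act g (C.b.act h ω) ∈ A j v := by
  obtain ⟨F, hFm, hFu⟩ := C.a.exists_subgroup_domain C.DG_meas C.DG_unique Γ
  let T : TreeCoupling Γ H (fun (j : K) (v w : H) => v⁻¹ * w ∈ L j) Ω ν :=
    { a := C.a.comap Γ.subtype
      b := C.b
      comm := fun g h ω => C.comm g h ω
      free := fun g h ω e => Subtype.ext (C.free g h ω e).1
      D := C.DH
      D_meas := C.DH_meas
      D_unique := C.DH_unique
      D_pos := C.DH_pos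
      D_fin := C.DH_fin
      E_smul := fun j v w h hvw => by simpa [mul_assoc] using hvw
      F := fun v => C.b.act v⁻¹ ⁻¹' F
      F_meas := fun v => C.b.measurable _ hFm
      F_smul := fun h ω v => by
        rw [Set.mem_preimage, Set.mem_preimage, ← C.b.act_mul]
        simp
      F_unique := fun ω v => by
        simp only [PMPAction.comap, Set.mem_preimage, ← C.comm]
        exact hFu _ }
  obtain ⟨U, h1, h2, h3, h4⟩ := T.exists_hyperedge_stabilizing hΓ hL.isHypertree 1
  refine ⟨fun j v => C.b.act v ⁻¹' U j v, fun j v => C.b.measurable v (h1 j v), ?_, ?_, ?_⟩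
  · intro j v ω h hω hω'
    obtain ⟨k, -, hk⟩ := C.DH_unique ω
    have e1 := hk _ (h2 j v hω)
    have e2 := hk (v * h) (by
      dsimp only
      rw [C.b.act_mul]
      exact h2 j v hω')
    simpa using e2.trans e1.symm
  · intro j v x hx x' hx' g h e
    have := h3 j v _ hx _ hx' g (v * h * v⁻¹) (by
      change C.a.act g (C.b.act v x) = C.b.act _ (C.b.act v x')
      rw [C.comm, e, ← C.b.act_mul, ← C.b.act_mul]
      simp)
    simpa [mul_assoc] using this
  · filter_upwards [h4] with ω ⟨g, h, j, v, hm⟩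
    refine ⟨g, v⁻¹ * h, j, v, ?_⟩
    rw [Set.mem_preimage, ← C.comm, ← C.b.act_mul, mul_inv_cancel_left]
    exact hm

end ExactCoupling

/-! ### Subgroups measure equivalent to free groups -/

/-- A countable free group embeds in a free product of involutions, which acts on a hypertree with
two-element hyperedges. -/
theorem FreeGroup.exists_small_hypertree (S : Type) [Countable S] :
    ∃ (W J : Type) (_ : Group W) (E : J → W → W → Prop) (φ : FreeGroup S →* W)
      (τ : W → FreeGroup S), Countable W ∧ Countable J ∧ IsHypertree E ∧
      (∀ j u v w, E j v w → E j (u * v) (u * w)) ∧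
      (∀ j v, ∃ v', ∀ w, E j v w → w = v ∨ w = v') ∧ ∀ f w, τ (φ f * w) = f * τ w := by
  let ι : FreeGroup S →* FreeGroup S := FreeGroup.lift fun s => (FreeGroup.of s)⁻¹
  have hι : ∀ x, ι (ι x) = x := by
    have : ι.comp ι = MonoidHom.id _ := by
      ext s
      simp [ι]
    exact DFunLike.congr_fun this
  have hιs : ∀ s, ι (FreeGroup.of s) = (FreeGroup.of s)⁻¹ := fun s => by simp [ι]
  let κ : S × Bool → FreeGroup S := fun k => if k.2 then FreeGroup.of k.1 else 1
  have hκ : ∀ k x, κ k * ι (κ k * ι x) = x := by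
    rintro ⟨s, b⟩ x
    cases b <;> simp [κ, hι, hιs]
  let σ : S × Bool → Equiv.Perm (FreeGroup S) := fun k =>
    ⟨fun x => κ k * ι x, fun x => κ k * ι x, hκ k, hκ k⟩
  have hσ : ∀ k, σ k * σ k = 1 := fun k => Equiv.ext (hκ k)
  let M : S × Bool → Type := fun k => Subgroup.zpowers (σ k)
  have hM : ∀ k (x : M k), x = 1 ∨ x = ⟨σ k, Subgroup.mem_zpowers _⟩ := by
    rintro k ⟨_, n, rfl⟩
    have h2 : σ k ^ (2 : ℤ) = 1 := by rw [zpow_two, hσ]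
    obtain ⟨m, rfl⟩ | ⟨m, rfl⟩ := Int.even_or_odd n
    · left
      apply Subtype.ext
      change σ k ^ (m + m) = 1
      rw [← two_mul, zpow_mul, h2, one_zpow]
    · right
      apply Subtype.ext
      change σ k ^ (2 * m + 1) = σ k
      rw [zpow_add, zpow_mul, h2, one_zpow, one_mul, zpow_one]
  have hMc : ∀ k, Countable (M k) := fun k => inferInstanceAs (Countable (Subgroup.zpowers (σ k)))
  have hWc : Countable (Monoid.CoprodI M) := by
    classical
    have : Function.Injective (Monoid.CoprodI.Word.toList (M := M)) := fun v w h =>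
      Monoid.CoprodI.Word.ext h
    have := this.countable
    exact Monoid.CoprodI.Word.equiv.countable_iff.2 this
  let t : ∀ k, Monoid.CoprodI M := fun k =>
    Monoid.CoprodI.of (⟨σ k, Subgroup.mem_zpowers _⟩ : M k)
  let ρ : Monoid.CoprodI M →* Equiv.Perm (FreeGroup S) :=
    Monoid.CoprodI.lift fun k => (Subgroup.zpowers (σ k)).subtype
  have hρt : ∀ k, ρ (t k) = σ k := fun k => Monoid.CoprodI.lift_of ..
  let φ : FreeGroup S →* Monoid.CoprodI M := FreeGroup.lift fun s => t (s, true) * t (s, false)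
  have hρφ : ρ.comp φ = MulAction.toPermHom (FreeGroup S) (FreeGroup S) := by
    ext s x
    simp [φ, hρt, σ, κ, hι]
  refine ⟨Monoid.CoprodI M, S × Bool, inferInstance, _, φ, fun w => ρ w 1, hWc, inferInstance,
    isHypertree_coprodI M, ?_, ?_, ?_⟩
  · intro j u v w h
    simpa [mul_assoc] using h
  · intro k v
    refine ⟨v * t k, ?_⟩
    rintro w ⟨m, hm⟩
    obtain rfl : v * Monoid.CoprodI.of m = w := by rw [hm, mul_inv_cancel_left]
    obtain rfl | rfl := hM k m
    · left
      simp
    · right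
      rfl
  · intro f w
    have := DFunLike.congr_fun hρφ f
    rw [MonoidHom.comp_apply] at this
    simp [this]

namespace ExactCoupling

variable {G H Ω : Type} [Group G] [Group H] [MeasurableSpace Ω] {ν : Measure Ω}

/-- A subgroup stabilizing a set of positive measure under an infinite measurably freely
indecomposable group is not measure equivalent to a free group. -/
theorem not_measureEquivalent_freeGroup [Countable G] [Countable H] [StandardBorelSpace Ω]
    (C : ExactCoupling G H Ω ν) (Γ : Subgroup G) [Infinite Γ] (hΓ : MFI Γ) (L : Subgroup H)
    {A : Set Ω} (hA : MeasurableSet A) (hpos : ν A ≠ 0)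
    (hinj : ∀ ω h, ω ∈ A → C.b.act h ω ∈ A → h = 1)
    (hL : ∀ x ∈ A, ∀ x' ∈ A, ∀ (g : Γ) h, C.a.act g x = C.b.act h x' → h ∈ L)
    {S : Type} [Countable S] : ¬ MeasureEquivalent L (FreeGroup S) := by
  intro hS
  obtain ⟨Ω₀, _, _, ν₀, ⟨C₀⟩⟩ := hS.exists_exactCoupling
  obtain ⟨W, J, _, E, φ, τ, _, _, hE, hEmul, hsmall, hτ⟩ := FreeGroup.exists_small_hypertree S
  obtain ⟨F, hFm, hFu⟩ := C.a.exists_subgroup_domain C.DG_meas C.DG_unique Γ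
  let a := C.a.comap Γ.subtype
  let b := C.b.comap L.subtype
  have comm : ∀ g l ω, a.act g (b.act l ω) = b.act l (a.act g ω) := fun g l ω => C.comm g l ω
  obtain ⟨D, hDm, hDs, hDu, hDpos, hDfin⟩ := a.exists_saturation_domain C.b
    (fun g h ω => C.comm g h ω) C.DH_meas C.DH_unique C.DH_fin hA hpos hinj L hL
  set X := a.saturation b A
  have hXm : MeasurableSet X := a.measurableSet_saturation b hA
  let aX := a.restrict X hXm (a.act_left_mem_saturation b A comm)
  let bX := b.restrict X hXm (a.act_right_mem_saturation b A)
  have := hXm.standardBorel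
  have hval : Subtype.val '' (Subtype.val ⁻¹' D : Set X) = D := by
    rw [Subtype.image_preimage_coe, Set.inter_eq_right.2 hDs]
  have hDX : ν.comap (Subtype.val : X → Ω) (Subtype.val ⁻¹' D) = ν D := by
    rw [comap_subtype_coe_apply hXm, hval]
  have hDXm : MeasurableSet (Subtype.val ⁻¹' D : Set X) := measurable_subtype_coe hDm
  have : SigmaFinite (ν.comap (Subtype.val : X → Ω)) :=
    bX.sigmaFinite_of_unique hDXm (fun x => hDu x x.2) (by rwa [hDX])
  have : SigmaFinite ν₀ := C₀.b.sigmaFinite_of_unique C₀.DH_meas C₀.DH_unique C₀.DH_fin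
  let _ : MulAction (L × FreeGroup S) W :=
    MulAction.compHom W (φ.comp (MonoidHom.snd L (FreeGroup S)))
  have hsmul : ∀ (p : L × FreeGroup S) (w : W), p • w = φ p.2 * w := fun _ _ => rfl
  let T : TreeCoupling Γ (L × FreeGroup S) E (X × Ω₀) ((ν.comap Subtype.val).prod ν₀) :=
    { a := aX.prod (PMPAction.trivial Γ ν₀)
      b := (bX.comap (MonoidHom.fst L (FreeGroup S))).prod (C₀.a.combine C₀.b C₀.comm)
      comm := fun g p x => Prod.ext (Subtype.ext (comm g p.1 x.1)) rfl
      free := fun g p x e => by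
        have e' : C.a.act g x.1 = C.b.act p.1 x.1 :=
          congrArg (fun y : X × Ω₀ => (y.1 : Ω)) e
        exact Subtype.ext (C.free _ _ _ e').1
      D := (Subtype.val ⁻¹' D) ×ˢ C₀.DH
      D_meas := hDXm.prod C₀.DH_meas
      D_unique := fun x => by
        obtain ⟨l, hl, hlu⟩ := hDu x.1 x.1.2
        obtain ⟨f, hf, hfu⟩ := C₀.DH_unique (C₀.a.act l x.2)
        have hf' : C₀.a.act l (C₀.b.act f x.2) ∈ C₀.DH := by rw [C₀.comm]; exact hf
        refine ⟨(l, f), ⟨hl, hf'⟩, ?_⟩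
        rintro ⟨l', f'⟩ ⟨hl', hf''⟩
        obtain rfl := hlu l' hl'
        refine Prod.ext rfl (hfu f' ?_)
        dsimp only
        rw [← C₀.comm]
        exact hf''
      D_pos := by
        rw [Measure.prod_prod, hDX]
        exact mul_ne_zero hDpos C₀.DH_pos
      D_fin := by
        rw [Measure.prod_prod, hDX]
        exact ENNReal.mul_ne_top hDfin C₀.DH_fin
      E_smul := fun j v w p h => hEmul j _ v w h
      F := fun w => {x | ∃ l, C₀.a.act l (C₀.b.act (τ w)⁻¹ x.2) ∈ C₀.DG ∧ C.b.act l x.1 ∈ F}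
      F_meas := fun w => by
        have h1 : ∀ l, Measurable fun x : X × Ω₀ =>
            C₀.a.act l (C₀.b.act (τ w)⁻¹ x.2) ∈ C₀.DG := fun l => measurable_mem.2
          (((C₀.a.measurable l).comp ((C₀.b.measurable _).comp measurable_snd)) C₀.DG_meas)
        have h2 : ∀ l : L, Measurable fun x : X × Ω₀ => C.b.act l x.1 ∈ F := fun l =>
          measurable_mem.2
            (((C.b.measurable l).comp (measurable_subtype_coe.comp measurable_fst)) hFm)
        apply measurableSet_setOfPred.2
        fun_prop
      F_smul := fun p x w => by
        rw [hsmul, Set.mem_ofPred_eq, Set.mem_ofPred_eq, hτ, mul_inv_rev]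
        refine (Equiv.mulRight p.1).exists_congr fun l => ?_
        change C₀.a.act l (C₀.b.act ((τ w)⁻¹ * p.2⁻¹) (C₀.a.act p.1 (C₀.b.act p.2 x.2))) ∈ C₀.DG ∧
          C.b.act l (C.b.act p.1 x.1) ∈ F ↔ C₀.a.act (l * p.1) (C₀.b.act (τ w)⁻¹ x.2) ∈ C₀.DG ∧
          C.b.act (l * p.1 : L) x.1 ∈ F
        rw [← C₀.comm, ← C₀.b.act_mul, inv_mul_cancel_right, ← C₀.a.act_mul, ← C.b.act_mul]
        rfl
      F_unique := fun x w => by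
        obtain ⟨l, hl, hlu⟩ := C₀.DG_unique (C₀.b.act (τ w)⁻¹ x.2)
        obtain ⟨g, hg, hgu⟩ := hFu (C.b.act l x.1)
        refine ⟨g, ⟨l, hl, ?_⟩, ?_⟩
        · change C.b.act l (C.a.act g x.1) ∈ F
          rw [← C.comm]
          exact hg
        · rintro g' ⟨l', hl', hg'⟩
          obtain rfl := hlu l' hl'
          refine hgu g' ?_
          dsimp only
          rw [C.comm]
          exact hg' }
  exact T.false_of_small_hyperedges hΓ hE 1 hsmall

end ExactCoupling

/-! ### Matching the free factors -/

namespace ExactCoupling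

variable {G H Ω : Type} [Group G] [Group H] [MeasurableSpace Ω] {ν : Measure Ω}

/-- Subgroups which stabilize each other on a set of positive measure are measure equivalent. -/
theorem measureEquivalent_of_stabilizing [Countable G] [Countable H] [StandardBorelSpace Ω]
    (C : ExactCoupling G H Ω ν) (Γ : Subgroup G) (L : Subgroup H)
    {A : Set Ω} (hA : MeasurableSet A) (hpos : ν A ≠ 0)
    (hinjG : ∀ ω g, ω ∈ A → C.a.act g ω ∈ A → g = 1)
    (hinjH : ∀ ω h, ω ∈ A → C.b.act h ω ∈ A → h = 1)
    (hL : ∀ x ∈ A, ∀ x' ∈ A, ∀ (g : Γ) h, C.a.act g x = C.b.act h x' → h ∈ L)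
    (hΓ : ∀ x ∈ A, ∀ x' ∈ A, ∀ (l : L) g, C.b.act l x = C.a.act g x' → g ∈ Γ) :
    MeasureEquivalent Γ L := by
  let a := C.a.comap Γ.subtype
  let b := C.b.comap L.subtype
  have comm : ∀ g l ω, a.act g (b.act l ω) = b.act l (a.act g ω) := fun g l ω => C.comm g l ω
  obtain ⟨D, hDm, hDs, hDu, hDpos, hDfin⟩ := a.exists_saturation_domain C.b
    (fun g h ω => C.comm g h ω) C.DH_meas C.DH_unique C.DH_fin hA hpos hinjH L hL
  obtain ⟨F, hFm, hFs, hFu, hFpos, hFfin⟩ := b.exists_saturation_domain C.a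
    (fun l g ω => (C.comm g l ω).symm) C.DG_meas C.DG_unique C.DG_fin hA hpos hinjG Γ hΓ
  change F ⊆ b.saturation a A at hFs
  change ∀ ω ∈ b.saturation a A, _ at hFu
  rw [← a.saturation_comm b A comm] at hFs hFu
  set X := a.saturation b A
  have hXm : MeasurableSet X := a.measurableSet_saturation b hA
  let aX := a.restrict X hXm (a.act_left_mem_saturation b A comm)
  let bX := b.restrict X hXm (a.act_right_mem_saturation b A)
  have := hXm.standardBorel
  have hval : ∀ B ⊆ X, ν.comap (Subtype.val : X → Ω) (Subtype.val ⁻¹' B) = ν B := by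
    intro B hB
    rw [comap_subtype_coe_apply hXm, Subtype.image_preimage_coe, Set.inter_eq_right.2 hB]
  have hDXm : MeasurableSet (Subtype.val ⁻¹' D : Set X) := measurable_subtype_coe hDm
  exact ⟨{
    Ω := X
    ν := ν.comap Subtype.val
    sigmaFinite := bX.sigmaFinite_of_unique hDXm (fun x => hDu x x.2) (by rwa [hval D hDs])
    aG := aX.act
    aH := bX.act
    DG := Subtype.val ⁻¹' F
    DH := Subtype.val ⁻¹' D
    aG_one := aX.act_one
    aG_mul := aX.act_mul
    aH_one := bX.act_one
    aH_mul := bX.act_mul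
    comm := fun g l x => Subtype.ext (comm g l x)
    mp_aG := aX.measurePreserving
    mp_aH := bX.measurePreserving
    free_aG := .of_forall fun x g e => by
      have e' : C.a.act g x = C.b.act 1 x := by
        rw [C.b.act_one]
        exact congrArg Subtype.val e
      exact Subtype.ext (C.free _ _ _ e').1
    free_aH := .of_forall fun x l e => by
      have e' : C.a.act 1 x = C.b.act l x := by
        rw [C.a.act_one]
        exact (congrArg Subtype.val e).symm
      exact Subtype.ext (C.free _ _ _ e').2
    fund_DG := aX.isFundamentalDomainFor (measurable_subtype_coe hFm) fun x => hFu x x.2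
    fund_DH := bX.isFundamentalDomainFor hDXm fun x => hDu x x.2
    DG_pos := by rw [hval F hFs]; exact hFpos.bot_lt
    DG_fin := by rw [hval F hFs]; exact hFfin.lt_top
    DH_pos := by rw [hval D hDs]; exact hDpos.bot_lt
    DH_fin := by rw [hval D hDs]; exact hDfin.lt_top }⟩

/-- An infinite measurably freely indecomposable free factor of `G` is measure equivalent to one of
the free factors of `H` which are not measure equivalent to free groups. -/
theorem exists_measureEquivalent_factor [Countable G] [Countable H] [StandardBorelSpace Ω]
    (C : ExactCoupling G H Ω ν) {K J : Type} [Countable K] [Countable J] {Γ : K → Subgroup G}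
    (hG : IsFreeProductOf G Γ) {Λ : J → Subgroup H} {Λ₀ : Subgroup H}
    (hH : IsFreeProductOf H fun j : Option J => j.elim Λ₀ Λ) (hΛinf : ∀ j, Infinite (Λ j))
    (hΛmfi : ∀ j, MFI (Λ j))
    (hΛ₀ : ∃ S : Type, Countable S ∧ MeasureEquivalent Λ₀ (FreeGroup S)) (i : K)
    [Infinite (Γ i)] (hΓ : MFI (Γ i)) : ∃ j, MeasureEquivalent (Γ i) (Λ j) := by
  obtain ⟨A, hAm, hAinj, hAL, hAe⟩ := C.exists_stabilizing_sets (Γ i) hΓ hH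
  have hpos : ∃ j v, ν (A j v) ≠ 0 := by
    by_contra! h0
    have h1 : ∀ᵐ ω ∂ν, ∀ j v, ω ∉ A j v := ae_all_iff.2 fun j => ae_all_iff.2 fun v =>
      measure_eq_zero_iff_ae_notMem.1 (h0 j v)
    have h2 : ∀ᵐ ω ∂ν, ω ∉ C.DG := by
      filter_upwards [hAe, (C.a.combine C.b C.comm).ae_act h1] with ω ⟨g, h, j, v, hm⟩ h3
      exact absurd hm (h3 (g, h) j v)
    exact C.DG_pos (measure_eq_zero_iff_ae_notMem.2 h2)
  obtain ⟨_ | j, v, hpos⟩ := hpos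
  · obtain ⟨S, _, hS⟩ := hΛ₀
    exact absurd hS (C.not_measureEquivalent_freeGroup (Γ i) hΓ Λ₀ (hAm none v) hpos
      (hAinj none v) (hAL none v))
  refine ⟨j, ?_⟩
  have := hΛinf j
  obtain ⟨B, hBm, hBinj, hBL, hBe⟩ := C.symm.exists_stabilizing_sets (Λ j) (hΛmfi j) hG
  change ∀ i v ω g, ω ∈ B i v → C.a.act g ω ∈ B i v → g = 1 at hBinj
  change ∀ i v, ∀ x ∈ B i v, ∀ x' ∈ B i v, ∀ (l : Λ j) g, C.b.act l x = C.a.act g x' → g ∈ Γ i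
    at hBL
  change ∀ᵐ ω ∂ν, ∃ (l : Λ j) (g : G) (i : K) (v : G), C.b.act l (C.a.act g ω) ∈ B i v at hBe
  have hpos' : ∃ (l : Λ j) (g : G) (i' : K) (v' : G),
      ν (A (some j) v ∩ {ω | C.b.act l (C.a.act g ω) ∈ B i' v'}) ≠ 0 := by
    by_contra! h0
    have h1 : ∀ᵐ ω ∂ν, ∀ (l : Λ j) (g : G) (i' : K) (v' : G),
        ω ∉ A (some j) v ∩ {ω | C.b.act l (C.a.act g ω) ∈ B i' v'} :=
      ae_all_iff.2 fun l => ae_all_iff.2 fun g => ae_all_iff.2 fun i' => ae_all_iff.2 fun v' =>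
        measure_eq_zero_iff_ae_notMem.1 (h0 l g i' v')
    have h2 : ∀ᵐ ω ∂ν, ω ∉ A (some j) v := by
      filter_upwards [hBe, h1] with ω ⟨l, g, i', v', hm⟩ h3 h4
      exact h3 l g i' v' ⟨h4, hm⟩
    exact hpos (measure_eq_zero_iff_ae_notMem.2 h2)
  obtain ⟨l, g, i', v', hpos'⟩ := hpos'
  set A' := A (some j) v ∩ {ω | C.b.act l (C.a.act g ω) ∈ B i' v'}
  have hA' : MeasurableSet A' :=
    (hAm _ _).inter (((C.b.measurable l).comp (C.a.measurable g)) (hBm i' v'))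
  have hinjH : ∀ ω h, ω ∈ A' → C.b.act h ω ∈ A' → h = 1 := fun ω h h1 h2 =>
    hAinj _ _ ω h h1.1 h2.1
  have hL : ∀ x ∈ A', ∀ x' ∈ A', ∀ (γ : Γ i) h, C.a.act γ x = C.b.act h x' → h ∈ Λ j :=
    fun x hx x' hx' => hAL _ _ x hx.1 x' hx'.1
  have hconj : ∀ k ω, C.b.act l (C.a.act g (C.a.act k ω)) =
      C.a.act (g * k * g⁻¹) (C.b.act l (C.a.act g ω)) := by
    intro k ω
    rw [C.comm, ← C.a.act_mul, ← C.a.act_mul, inv_mul_cancel_right]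
  have hinjG : ∀ ω k, ω ∈ A' → C.a.act k ω ∈ A' → k = 1 := by
    intro ω k h1 h2
    have h3 : C.b.act l (C.a.act g (C.a.act k ω)) ∈ B i' v' := h2.2
    rw [hconj] at h3
    exact conj_eq_one_iff.1 (hBinj _ _ _ _ h1.2 h3)
  have hΓ' : ∀ x ∈ A', ∀ x' ∈ A', ∀ (m : Λ j) k, C.b.act m x = C.a.act k x' →
      g * k * g⁻¹ ∈ Γ i' := by
    intro x hx x' hx' m k e
    refine hBL _ _ _ hx.2 _ hx'.2 (l * m * l⁻¹) _ ?_
    rw [← hconj, ← e, C.comm, ← C.b.act_mul, ← C.b.act_mul, Subgroup.coe_mul, Subgroup.coe_mul,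
      Subgroup.coe_inv, inv_mul_cancel_right]
  obtain ⟨γ, hγ1, x, hx, x', hx', h, e⟩ := (C.a.comap (Γ i).subtype).exists_return C.b
    (fun γ h ω => C.comm γ h ω) C.DH_meas C.DH_unique C.DH_fin hA' hpos' hinjH
  obtain ⟨rfl, hgi⟩ := hG.malnormal (g := g⁻¹) γ.2 (fun e => hγ1 (Subtype.ext e)) (by
    rw [inv_inv]
    exact hΓ' x' hx' x hx ⟨h, hL x hx x' hx' γ h e⟩ γ e.symm)
  refine C.measureEquivalent_of_stabilizing (Γ i') (Λ j) hA' hpos' hinjG hinjH hL ?_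
  intro x hx x' hx' m k e
  have := mul_mem (mul_mem hgi (hΓ' x hx x' hx' m k e)) (inv_mem hgi)
  simpa [mul_assoc] using this

end ExactCoupling

/-- Measure equivalence Bass-Serre rigidity for free products of MFI groups,
allowing extra free factors measure equivalent to free groups. -/
theorem ME_BassSerre_rigidity
    {G H : Type} [Group G] [Countable G] [Group H] [Countable H]
    {I J : Type} [Nonempty I] [Countable I] [Nonempty J] [Countable J]
    (Γ : I → Subgroup G) (Γ₀ : Subgroup G) (Λ : J → Subgroup H) (Λ₀ : Subgroup H)
    (hG : IsFreeProductOf G (fun i : Option I => i.elim Γ₀ Γ))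
    (hH : IsFreeProductOf H (fun j : Option J => j.elim Λ₀ Λ))
    (hΓinf : ∀ i, Infinite (Γ i)) (hΛinf : ∀ j, Infinite (Λ j))
    (hΓmfi : ∀ i, MFI (Γ i)) (hΛmfi : ∀ j, MFI (Λ j))
    (hΓ₀ : ∃ S : Type, Countable S ∧ MeasureEquivalent (↥Γ₀) (FreeGroup S))
    (hΛ₀ : ∃ S : Type, Countable S ∧ MeasureEquivalent (↥Λ₀) (FreeGroup S))
    (hME : MeasureEquivalent G H) :
    ∃ (θ : I → J) (θ' : J → I),
      (∀ i, MeasureEquivalent (↥(Γ i)) (↥(Λ (θ i)))) ∧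
      (∀ j, MeasureEquivalent (↥(Λ j)) (↥(Γ (θ' j)))) := by
  obtain ⟨Ω, _, _, ν, ⟨C⟩⟩ := hME.exists_exactCoupling
  have h : ∀ i, ∃ j, MeasureEquivalent (Γ i) (Λ j) := fun i =>
    have : Infinite ((fun i : Option I => i.elim Γ₀ Γ) (some i)) := hΓinf i
    C.exists_measureEquivalent_factor hG hH hΛinf hΛmfi hΛ₀ (some i) (hΓmfi i)
  have h' : ∀ j, ∃ i, MeasureEquivalent (Λ j) (Γ i) := fun j =>
    have : Infinite ((fun j : Option J => j.elim Λ₀ Λ) (some j)) := hΛinf j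
    C.symm.exists_measureEquivalent_factor hH hG hΓinf hΓmfi hΓ₀ (some j) (hΛmfi j)
  choose θ hθ using h
  choose θ' hθ' using h'
  exact ⟨θ, θ', hθ, hθ'⟩
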